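/- Let G be a locally compact σ-compact group, let 0 → J → A →^π B → 0 be an extension of σ-unital G-C*-algebras, and let X ⊆ M(A) be a norm-separable self-adjoint subspace of the multiplier algebra of A. Let π° : M(A) → M(B) be the induced homomorphism on multiplier algebras. Then for every z in the commutant M(B) ∩ π°(X)′ of π°(X) in M(B) such that g·z = z for all g ∈ G, there exists y ∈ M(A) such that π°(y) = z, [y, x] ∈ J for all x ∈ X, g·y − y ∈ J for all g ∈ G, and the map G ∋ g ↦ g·y is norm-continuous. -/

import Mathlib

/-!
Statement 1 (Cuntz–Gabe, Proposition 2.2: equivariant noncommutative Tietze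
extension theorem).

Setting: `G` a locally compact σ-compact (topological) group; an extension
`0 → J → A →π B → 0` of σ-unital `G`-C*-algebras, which we encode as a surjective
`G`-equivariant *-homomorphism `π : A → B` with kernel `J = {a | π a = 0}`.
`𝓜(ℂ, ·)` denotes the multiplier algebra (Mathlib's `DoubleCentralizer`), `π°` the
induced homomorphism on multiplier algebras (characterized by extending `π`), and
the actions on the multiplier algebras are the canonical extensions (characterized
by extending the actions on `A`, `B`).

Conclusion: for every `G`-invariant `z ∈ 𝓜(B)` commuting with `π°(X)`, where
`X ⊆ 𝓜(A)` is a norm-separable self-adjoint subspace, there is `y ∈ 𝓜(A)` with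
`π°(y) = z`, `[y, X] ⊆ J`, `g·y - y ∈ J` for all `g`, and `g ↦ g·y` norm-continuous.
-/

noncomputable section
open scoped MultiplierAlgebra

/-- A C*-algebra is σ-unital iff it admits a countable (positive, contractive)
approximate unit. -/
def SigmaUnital (A : Type) [NonUnitalCStarAlgebra A] [PartialOrder A]
    [StarOrderedRing A] : Prop :=
  ∃ e : ℕ → A, (∀ n, 0 ≤ e n ∧ ‖e n‖ ≤ 1) ∧
    ∀ x : A, Filter.Tendsto (fun n => e n * x) Filter.atTop (nhds x)

noncomputable section
open scoped MultiplierAlgebra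
open Filter Topology

namespace Tz

section basic
variable {M : Type} [CStarAlgebra M]

/-- Contraction estimate. -/
lemma norm_conj_add_le {Q c h k : M} {C : ℝ} (hC : 0 ≤ C) (hQ : star Q = Q) (hc : star c = c)
    (hh : star h = h) (hk : star k = k) (hhk : h * h + k * k = 1)
    (hQn : ‖Q‖ ≤ C) (hcn : ‖c‖ ≤ C) : ‖h * Q * h + k * c * k‖ ≤ C := by
  let _ := CStarAlgebra.spectralOrder M
  have := CStarAlgebra.spectralOrderedRing M
  have key : ∀ Q c : M, IsSelfAdjoint Q → IsSelfAdjoint c → ‖Q‖ ≤ C → ‖c‖ ≤ C →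
      h * Q * h + k * c * k ≤ algebraMap ℝ M C := by
    intro Q c hQ hc hQn hcn
    have h1 : h * Q * h ≤ C • (h * h) := by
      have := CStarAlgebra.star_left_conjugate_le_norm_smul (a := h) (b := Q) hQ
      rw [hh] at this
      refine this.trans ?_
      have h0 : 0 ≤ h * h := by simpa [hh] using star_mul_self_nonneg h
      exact smul_le_smul_of_nonneg_right hQn h0
    have h2 : k * c * k ≤ C • (k * k) := by
      have := CStarAlgebra.star_left_conjugate_le_norm_smul (a := k) (b := c) hc
      rw [hk] at this
      refine this.trans ?_
      have h0 : 0 ≤ k * k := by simpa [hk] using star_mul_self_nonneg k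
      exact smul_le_smul_of_nonneg_right hcn h0
    calc _ ≤ C • (h * h) + C • (k * k) := add_le_add h1 h2
      _ = algebraMap ℝ M C := by rw [← smul_add, hhk, Algebra.algebraMap_eq_smul_one]
  have hS : IsSelfAdjoint (h * Q * h + k * c * k) := by
    simp [IsSelfAdjoint, hQ, hc, hh, hk, mul_assoc]
  have u1 := key Q c hQ hc hQn hcn
  have u2 := key (-Q) (-c) (by simpa [IsSelfAdjoint] using hQ)
    (by simpa [IsSelfAdjoint] using hc) (by simpa using hQn) (by simpa using hcn)
  have u3 : -algebraMap ℝ M C ≤ h * Q * h + k * c * k := by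
    rw [neg_le]
    refine le_trans (le_of_eq ?_) u2
    noncomm_ring
  rcases subsingleton_or_nontrivial M with hM | hM
  · rw [Subsingleton.elim (h * Q * h + k * c * k) 0, norm_zero]; exact hC
  rcases CStarAlgebra.norm_or_neg_norm_mem_spectrum hS with hs | hs
  · exact (le_algebraMap_iff_spectrum_le (a := h * Q * h + k * c * k)).1 u1 _ hs
  · have := (algebraMap_le_iff_le_spectrum (a := h * Q * h + k * c * k) (r := -C)).1 (by simpa using u3) _ hs
    linarith

lemma norm_le_one_of_sq_add_sq {h k : M} 
    (hh : star h = h) (hk : star k = k) (hhk : h * h + k * k = 1) : ‖k‖ ≤ 1 := by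
  nontriviality M
  have := norm_conj_add_le (Q := (0 : M)) (c := 1) (h := h) (k := k) (C := 1) zero_le_one (by simp)
    (by simp) hh hk hhk (by simp) (by simp)
  have h2 : ‖k * k‖ = ‖k‖ * ‖k‖ := by
    conv_lhs => rw [← hk]
    rw [hk]
    nth_rw 1 [← hk]
    exact CStarRing.norm_star_mul_self
  simp [h2] at this
  nlinarith [norm_nonneg k]

/-- the pair `(h,k)` built from a self-adjoint contraction `v`. -/
lemma exists_hk (v : M) (hv : star v = v) (hv1 : ‖v‖ ≤ 1) : ∃ w : M, star w = w ∧ ‖w‖ ≤ 1 ∧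
    w * (1 + v * v) = 1 ∧ (1 + v * v) * w = 1 ∧ v * w = w * v ∧
    star (2 • w - 1) = 2 • w - 1 ∧ star (2 • (w * v)) = 2 • (w * v) ∧
    (2 • (w * v)) * (2 • (w * v)) + (2 • w - 1) * (2 • w - 1) = 1 ∧
    ‖(2 • w - 1)‖ ≤ 1 ∧ ‖2 • (w * v)‖ ≤ 1 ∧
    (∀ a, ‖(2 • w - 1) * a‖ ≤ 2 * ‖v * a - a‖) ∧
    (∀ a, ‖(2 • (w * v)) * a - a‖ ≤ 2 * ‖v * a - a‖) := by
  nontriviality M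
  have hu : IsUnit (1 + v * v) := by
    let _ := CStarAlgebra.spectralOrder M
    have := CStarAlgebra.spectralOrderedRing M
    have : 0 ≤ v * v := by simpa [hv] using star_mul_self_nonneg v
    exact CStarAlgebra.isUnit_of_le 1 (by simpa using this) 
  obtain ⟨u, hu⟩ := hu
  set w : M := ↑u⁻¹ with hw
  have h1 : w * (1 + v * v) = 1 := by rw [← hu]; simp [hw]
  have h2 : (1 + v * v) * w = 1 := by rw [← hu]; simp [hw]
  have hcomm : v * w = w * v := by
    calc v * w = (w * (1 + v * v)) * (v * w) := by rw [h1, one_mul]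
      _ = w * v * ((1 + v * v) * w) := by noncomm_ring
      _ = w * v := by rw [h2, mul_one]
  have hsw : star w = w := by
    have h3 : star w * (1 + v * v) = 1 := by
      have := congrArg star h2
      simpa [hv] using this
    calc star w = star w * ((1 + v * v) * w) := by rw [h2, mul_one]
      _ = w := by rw [← mul_assoc, h3, one_mul]
  have hk : star (2 • w - 1) = 2 • w - 1 := by rw [two_smul, star_sub, star_add, hsw, star_one]
  have hh : star (2 • (w * v)) = 2 • (w * v) := by rw [two_smul, star_add, star_mul, hsw, hv, hcomm]
  have hsum : (2 • (w * v)) * (2 • (w * v)) + (2 • w - 1) * (2 • w - 1) = 1 := by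
    have : (w * v) * (w * v) = w - w * w := by
      calc (w * v) * (w * v) = w * (v * w) * v := by noncomm_ring
        _ = w * (w * v) * v := by rw [hcomm]
        _ = w * (w * (1 + v * v)) - w * w := by noncomm_ring
        _ = _ := by rw [h1, mul_one]
    have e : (2 • (w * v)) * (2 • (w * v)) + (2 • w - 1) * (2 • w - 1)
      = 4 • ((w * v) * (w * v)) + (2 • w - 1) * (2 • w - 1) := by noncomm_ring
    rw [e, this]
    noncomm_ring
  have hkn : ‖2 • w - 1‖ ≤ 1 := norm_le_one_of_sq_add_sq hh hk hsum
  have hhn : ‖2 • (w * v)‖ ≤ 1 := norm_le_one_of_sq_add_sq hk hh (by rw [add_comm]; exact hsum)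
  have hwn : ‖w‖ ≤ 1 := by
    have e : w = (2⁻¹ : ℂ) • ((2 • w - 1) + 1) := by
      rw [sub_add_cancel, ← Nat.cast_smul_eq_nsmul ℂ, smul_smul]; simp
    rw [e, norm_smul]
    have := norm_add_le (2 • w - 1) (1 : M)
    simp only [norm_one] at this
    rw [norm_inv, Complex.norm_two]
    linarith
  refine ⟨w, hsw, hwn, h1, h2, hcomm, hk, hh, hsum, hkn, hhn, ?_, ?_⟩
  · intro a
    have e : (2 • w - 1) * a = - (w * ((1 + v) * (v * a - a))) := by
      calc (2 • w - 1) * a = (2 • w - w * (1 + v * v)) * a := by rw [h1]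
        _ = _ := by noncomm_ring
    rw [e, norm_neg]
    have n1 : ‖1 + v‖ ≤ 2 := by
      have := norm_add_le 1 v
      simp only [norm_one] at this
      linarith
    calc _ ≤ ‖w‖ * (‖1 + v‖ * ‖v * a - a‖) := (norm_mul_le _ _).trans (by gcongr; exact norm_mul_le _ _)
      _ ≤ 1 * (2 * ‖v * a - a‖) := by gcongr
      _ = _ := by ring
  · intro a
    have e : (2 • (w * v)) * a - a = - (w * ((v - 1) * (v * a - a))) := by
      calc (2 • (w * v)) * a - a = (2 • (w * v)) * a - (w * (1 + v * v)) * a := by rw [h1, one_mul]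
        _ = _ := by noncomm_ring
    rw [e, norm_neg]
    have n1 : ‖v - 1‖ ≤ 2 := by
      have := norm_sub_le v 1
      simp only [norm_one] at this
      linarith
    calc _ ≤ ‖w‖ * (‖v - 1‖ * ‖v * a - a‖) := (norm_mul_le _ _).trans (by gcongr; exact norm_mul_le _ _)
      _ ≤ 1 * (2 * ‖v * a - a‖) := by gcongr
      _ = _ := by ring

/-- (twisted) derivations are small on `h` and `k`. -/
lemma deriv_hk {E : Type} [NormedRing E] [Module ℂ E] (D : M →ₗ[ℂ] E) (L : M →+* E) (R : M → E)
    (hL : ∀ a, ‖L a‖ ≤ ‖a‖) (hR : ∀ a, ‖R a‖ ≤ ‖a‖)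
    (hD : ∀ a b, D (a * b) = D a * R b + L a * D b) (hD1 : D 1 = 0)
    {v w : M} (hv1 : ‖v‖ ≤ 1) (hw1 : ‖w‖ ≤ 1) (h1 : w * (1 + v * v) = 1)
    (h2 : (1 + v * v) * w = 1) {η : ℝ} (hη : ‖D v‖ ≤ η) :
    ‖D (2 • w - 1)‖ ≤ 6 * η ∧ ‖D (2 • (w * v))‖ ≤ 6 * η := by
  have hη0 : 0 ≤ η := (norm_nonneg _).trans hη
  have hmul : ∀ a b, ‖a‖ ≤ 1 → ‖b‖ ≤ 1 → ‖D (a * b)‖ ≤ ‖D a‖ + ‖D b‖ := by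
    intro a b ha hb
    rw [hD]
    have i1 : ‖D a * R b‖ ≤ ‖D a‖ * 1 := (norm_mul_le _ _).trans (by gcongr; exact (hR b).trans hb)
    have i2 : ‖L a * D b‖ ≤ 1 * ‖D b‖ := (norm_mul_le _ _).trans (by gcongr; exact (hL a).trans ha)
    have := norm_add_le (D a * R b) (L a * D b)
    linarith
  have hvv : ‖D (v * v)‖ ≤ 2 * η := by linarith [hmul v v hv1 hv1]
  have hw : ‖D w‖ ≤ 2 * η := by
    have e : D w = - (L w * (D (v * v) * R w)) := by
      have e1 : D ((1 + v * v) * w) = 0 := by rw [h2, hD1]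
      rw [hD, map_add, hD1, zero_add] at e1
      have e2 : L w * L (1 + v * v) = 1 := by rw [← map_mul, h1, map_one]
      calc D w = (L w * L (1 + v * v)) * D w := by rw [e2, one_mul]
        _ = L w * (D (v * v) * R w + L (1 + v * v) * D w) - L w * (D (v * v) * R w) := by noncomm_ring
        _ = _ := by rw [e1]; simp
    rw [e, norm_neg]
    calc _ ≤ ‖L w‖ * (‖D (v * v)‖ * ‖R w‖) := (norm_mul_le _ _).trans (by gcongr; exact norm_mul_le _ _)
      _ ≤ 1 * (2 * η * 1) := by
        gcongr
        · exact (hL w).trans hw1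
        · exact (hR w).trans hw1
      _ = _ := by ring
  constructor
  · rw [map_sub, hD1, sub_zero, two_smul, map_add]
    linarith [norm_add_le (D w) (D w)]
  · rw [two_smul, map_add]
    linarith [norm_add_le (D (w * v)) (D (w * v)), hmul w v hw1 hv1]

/-- elementary Banach–Saks type lemma -/
lemma exists_average {E T : Type} [NormedRing E] [StarRing E] [CStarRing E]
    (p : ℕ → T → E) (K : Set T) (C : ℝ) (hC : ∀ n, ∀ t ∈ K, ‖p n t‖ ≤ C)
    (hp : ∀ k, ∀ ε > 0, ∃ m0, ∀ m ≥ m0, ∀ t ∈ K, ‖star (p k t) * p m t‖ ≤ ε)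
    (n0 : ℕ) (ε : ℝ) (hε : 0 < ε) :
    ∃ s : Finset ℕ, s.Nonempty ∧ (∀ m ∈ s, n0 ≤ m) ∧
      ∀ t ∈ K, ‖∑ m ∈ s, p m t‖ ≤ ε * s.card := by
  have key : ∀ N : ℕ, ∃ s : Finset ℕ, s.card = N ∧ (∀ m ∈ s, n0 ≤ m) ∧
      ∀ t ∈ K, ‖∑ m ∈ s, p m t‖ ^ 2 ≤ N * (C ^ 2 + 1) := by
    intro N
    induction N with
    | zero => exact ⟨∅, by simp, by simp, by simp⟩
    | succ N ih =>
      obtain ⟨s, hs, hs0, hsN⟩ := ih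
      have hδ : (0 : ℝ) < 1 / (2 * (N + 1)) := by positivity
      choose f hf using fun k => hp k _ hδ
      set m := n0 + (∑ k ∈ s, f k) + (∑ k ∈ s, k) + 1 with hm
      have hms : m ∉ s := by
        intro h
        have := Finset.single_le_sum (f := fun k : ℕ => k) (fun i _ => Nat.zero_le i) h
        omega
      refine ⟨insert m s, by rw [Finset.card_insert_of_notMem hms, hs], ?_, ?_⟩
      · intro k hk
        rcases Finset.mem_insert.1 hk with rfl | hk
        · omega
        · exact hs0 k hk
      · intro t ht
        rw [Finset.sum_insert hms]
        set S := ∑ k ∈ s, p k t with hS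
        have h1 : ‖star S * p m t‖ ≤ 1 / 2 := by
          rw [hS, star_sum, Finset.sum_mul]
          refine (norm_sum_le _ _).trans ?_
          have : ∀ k ∈ s, ‖star (p k t) * p m t‖ ≤ 1 / (2 * (N + 1)) := by
            intro k hk
            refine hf k m ?_ t ht
            have := Finset.single_le_sum (f := f) (fun i _ => Nat.zero_le _) hk
            omega
          refine (Finset.sum_le_sum this).trans ?_
          rw [Finset.sum_const, hs, nsmul_eq_mul, mul_one_div, div_le_div_iff₀ (by positivity) (by norm_num)]
          linarith
        have h2 : ‖star (p m t) * S‖ ≤ 1 / 2 := by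
          rw [← norm_star]; simpa using h1
        have h3 : ‖star S * S‖ ≤ N * (C ^ 2 + 1) := by
          rw [CStarRing.norm_star_mul_self, ← sq]; exact hsN t ht
        have h4 : ‖star (p m t) * p m t‖ ≤ C ^ 2 := by
          rw [CStarRing.norm_star_mul_self, ← sq]
          exact pow_le_pow_left₀ (norm_nonneg _) (hC m t ht) 2
        rw [sq, ← CStarRing.norm_star_mul_self]
        have e : star (p m t + S) * (p m t + S) = star (p m t) * p m t + star (p m t) * S
          + star S * p m t + star S * S := by rw [star_add]; noncomm_ring
        rw [e]
        have := norm_add₄_le (a := star (p m t) * p m t) (b := star (p m t) * S)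
          (c := star S * p m t) (d := star S * S)
        push_cast
        linarith
  obtain ⟨N, hN⟩ := exists_nat_gt ((C ^ 2 + 1) / ε ^ 2)
  have hN0 : (0 : ℝ) < N := lt_trans (by positivity) hN
  obtain ⟨s, hs, hs0, hsN⟩ := key N
  refine ⟨s, ?_, hs0, ?_⟩
  · rw [← Finset.card_pos, hs]; exact_mod_cast hN0
  · intro t ht
    refine abs_le_of_sq_le_sq' ?_ (by positivity) |>.2
    refine (hsN t ht).trans ?_
    rw [hs]
    rw [div_lt_iff₀ (by positivity)] at hN
    nlinarith

lemma avg_norm_le {E : Type} [NormedRing E] [NormedAlgebra ℂ E] (s : Finset ℕ) (hs : s.Nonempty)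
    (f : ℕ → E) (η : ℝ) (h : ‖∑ m ∈ s, f m‖ ≤ η * s.card) :
    ‖((s.card : ℂ)⁻¹) • ∑ m ∈ s, f m‖ ≤ η := by
  have : (0 : ℝ) < s.card := by exact_mod_cast hs.card_pos
  rw [norm_smul, norm_inv]
  simp only [Complex.norm_natCast]
  rw [inv_mul_le_iff₀ this]
  linarith

end basic

end Tz
end

noncomputable section
open scoped MultiplierAlgebra
open Filter Topology

namespace Tz

lemma compact_uniform {M : Type} [NormedRing M] (F : ℕ → M → ℝ) (L : Set M) (hL : IsCompact L)
    (hF : ∀ m a b, F m a ≤ F m b + 2 * ‖a - b‖) (η : ℝ)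
    (h : ∀ a ∈ L, ∃ m0, ∀ m ≥ m0, F m a ≤ η) (ε : ℝ) (hε : 0 < ε) :
    ∃ m0, ∀ m ≥ m0, ∀ a ∈ L, F m a ≤ η + ε := by
  obtain ⟨s, hsL, hs, hcov⟩ := hL.finite_cover_balls (e := ε / 2) (by positivity)
  have : ∃ m0, ∀ m ≥ m0, ∀ a ∈ s, F m a ≤ η := by
    have := (Set.Finite.eventually_all hs (l := atTop) (p := fun a m => F m a ≤ η)).2
      (fun a ha => eventually_atTop.2 (h a (hsL ha)))
    exact eventually_atTop.1 this
  obtain ⟨m0, hm0⟩ := this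
  refine ⟨m0, fun m hm a ha => ?_⟩
  obtain ⟨b, hb, hab⟩ := Set.mem_iUnion₂.1 (hcov ha)
  have h1 := hF m a b
  have h2 := hm0 m hm b hb
  rw [Metric.mem_ball, dist_eq_norm] at hab
  linarith

/-- A family of twisted derivations. -/
structure TestSys {T M : Type} [CStarAlgebra M] (δ τ : T → M →ₗ[ℂ] M) (σ : T → M → M) : Prop where
  δ_mul : ∀ t a b, δ t (a * b) = δ t a * σ t b + a * δ t b
  δ_one : ∀ t, δ t 1 = 0
  δ_norm : ∀ t a, ‖δ t a‖ ≤ 2 * ‖a‖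
  τ_norm : ∀ t a, ‖τ t a‖ ≤ 2 * ‖a‖
  σ_norm : ∀ t a, ‖σ t a‖ ≤ ‖a‖
  tw : ∀ t a b, ‖δ t a * σ t b - δ t a‖ ≤ ‖τ t a * b - τ t a‖

/-- An ideal with a sequential approximate unit, compatible with everything. -/
structure GoodIdeal {T M N : Type} [TopologicalSpace T] [CStarAlgebra M] [CStarAlgebra N]
    (δ τ : T → M →ₗ[ℂ] M) (Φ : M →⋆ₐ[ℂ] N) (z : N) (S : Submodule ℂ M) (e : ℕ → M) : Prop where
  mul_left : ∀ m a, a ∈ S → m * a ∈ S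
  star_mem : ∀ a ∈ S, star a ∈ S
  δ_mem : ∀ t, ∀ a ∈ S, δ t a ∈ S
  τ_mem : ∀ t, ∀ a ∈ S, τ t a ∈ S
  δ_cont : ∀ a ∈ S, Continuous fun t => δ t a
  τ_cont : ∀ a ∈ S, Continuous fun t => τ t a
  zr : ∀ a ∈ S, ∃ a' ∈ S, Φ a' = Φ a * z
  zl : ∀ a ∈ S, ∃ a' ∈ S, Φ a' = z * Φ a
  e_mem : ∀ n, e n ∈ S
  e_star : ∀ n, star (e n) = e n
  e_norm : ∀ n, ‖e n‖ ≤ 1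
  e_tend : ∀ a ∈ S, Tendsto (fun n => e n * a) atTop (𝓝 a)

section
variable {T M N : Type} [TopologicalSpace T] [CStarAlgebra M] [CStarAlgebra N]
    {δ τ : T → M →ₗ[ℂ] M} {σ : T → M → M} {Φ : M →⋆ₐ[ℂ] N} {z : N}
    {S : Submodule ℂ M} {e : ℕ → M}

lemma GoodIdeal.mul_right (hS : GoodIdeal δ τ Φ z S e) (m a : M) (ha : a ∈ S) : a * m ∈ S := by
  have := hS.star_mem _ (hS.mul_left (star m) _ (hS.star_mem a ha))
  simpa using this

lemma hom_norm (Φ : M →⋆ₐ[ℂ] N) (a : M) : ‖Φ a‖ ≤ ‖a‖ := NonUnitalStarAlgHom.norm_apply_le Φ a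

lemma TestSys.norm_mul_le (hT : TestSys δ τ σ) (t : T) (a b : M) :
    ‖δ t (a * b)‖ ≤ ‖δ t a‖ * ‖b‖ + ‖a‖ * ‖δ t b‖ := by
  rw [hT.δ_mul]
  refine (norm_add_le _ _).trans (add_le_add ?_ (_root_.norm_mul_le _ _))
  refine (_root_.norm_mul_le _ _).trans ?_
  gcongr
  exact hT.σ_norm t b

lemma joint_cont (f : T → M →ₗ[ℂ] M) (hf : ∀ t a, ‖f t a‖ ≤ 2 * ‖a‖)
    (hS : ∀ a ∈ S, Continuous fun t => f t a) (a : T → M) (ha : Continuous a) (haS : ∀ t, a t ∈ S) :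
    Continuous fun t => f t (a t) := by
  rw [continuous_iff_continuousAt]
  intro t0
  have h1 : Tendsto (fun t => f t (a t - a t0)) (𝓝 t0) (𝓝 0) := by
    apply squeeze_zero_norm (fun t => hf t _)
    have : Continuous fun t => 2 * ‖a t - a t0‖ := by fun_prop
    simpa using this.tendsto t0
  have h2 := (hS (a t0) (haS t0)).tendsto t0
  have := h1.add h2
  simpa [ContinuousAt] using this

lemma GoodIdeal.uniform_left (hS : GoodIdeal δ τ Φ z S e) (L : Set M) (hL : IsCompact L)
    (hLS : ∀ a ∈ L, a ∈ S) (ε : ℝ) (hε : 0 < ε) :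
    ∃ m0, ∀ m ≥ m0, ∀ a ∈ L, ‖e m * a - a‖ ≤ ε := by
  have := compact_uniform (fun m a => ‖e m * a - a‖) L hL ?_ (ε / 2) ?_ (ε / 2) (by positivity)
  · simpa using this
  · intro m a b
    have e1 : e m * a - a = (e m * b - b) + (e m * (a - b) - (a - b)) := by noncomm_ring
    rw [e1]
    have h1 : ‖e m * (a - b)‖ ≤ 1 * ‖a - b‖ := (norm_mul_le _ _).trans (by gcongr; exact hS.e_norm m)
    have h2 := norm_add_le (e m * b - b) (e m * (a - b) - (a - b))
    have h3 := norm_sub_le (e m * (a - b)) (a - b)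
    linarith
  · intro a ha
    have := (hS.e_tend a (hLS a ha))
    rw [Metric.tendsto_atTop] at this
    obtain ⟨m0, h⟩ := this (ε / 2) (by positivity)
    exact ⟨m0, fun m hm => by have := h m hm; rw [dist_eq_norm] at this; exact this.le⟩

lemma GoodIdeal.uniform_right (hS : GoodIdeal δ τ Φ z S e) (L : Set M) (hL : IsCompact L)
    (hLS : ∀ a ∈ L, a ∈ S) (ε : ℝ) (hε : 0 < ε) :
    ∃ m0, ∀ m ≥ m0, ∀ a ∈ L, ‖a * e m - a‖ ≤ ε := by
  obtain ⟨m0, h⟩ := hS.uniform_left (star '' L) (hL.image continuous_star)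
    (by rintro _ ⟨a, ha, rfl⟩; exact hS.star_mem a (hLS a ha)) ε hε
  refine ⟨m0, fun m hm a ha => ?_⟩
  have := h m hm (star a) ⟨a, ha, rfl⟩
  rw [← norm_star] at this
  simpa [hS.e_star] using this

/-- Existence of quasi-central almost invariant elements (lemma of Kasparov). -/
lemma GoodIdeal.kasparov (hT : TestSys δ τ σ) (hS : GoodIdeal δ τ Φ z S e) (hz : star z = z)
    (K : Set T) (hK : IsCompact K)
    (P : ℕ → Prop) (hP : ∃ m0, ∀ m ≥ m0, P m) (ε : ℝ) (hε : 0 < ε) :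
    ∃ v ∈ S, star v = v ∧ ‖v‖ ≤ 1 ∧ (∀ t ∈ K, ‖δ t v‖ ≤ ε) ∧ ‖Φ v * z - z * Φ v‖ ≤ ε ∧
      ∀ a : M, ∀ η : ℝ, (∀ m, P m → ‖e m * a - a‖ ≤ η) → ‖v * a - a‖ ≤ η := by
  obtain ⟨n0, hn0⟩ := hP
  let p : ℕ → Option K → M × N := fun m t =>
    ((match t with | none => 0 | some t => δ t.1 (e m)), Φ (e m) * z - z * Φ (e m))
  have hpC : ∀ n, ∀ t ∈ (Set.univ : Set (Option K)), ‖p n t‖ ≤ 2 + 2 * ‖z‖ := by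
    intro n t _
    rw [Prod.norm_def]
    have he := hS.e_norm n
    have hΦ : ‖Φ (e n)‖ ≤ 1 := (hom_norm Φ _).trans he
    refine max_le ?_ ?_
    · rcases t with _ | t
      · simp only [p, norm_zero]; positivity
      · simp only [p]
        have := hT.δ_norm t.1 (e n)
        linarith [norm_nonneg z]
    · simp only [p]
      have h1 := norm_sub_le (Φ (e n) * z) (z * Φ (e n))
      have h2 : ‖Φ (e n) * z‖ ≤ 1 * ‖z‖ := (norm_mul_le _ _).trans (by gcongr)
      have h3 : ‖z * Φ (e n)‖ ≤ ‖z‖ * 1 := (norm_mul_le _ _).trans (by gcongr)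
      linarith
  have hp : ∀ k, ∀ ε > 0, ∃ m0, ∀ m ≥ m0, ∀ t ∈ (Set.univ : Set (Option K)),
      ‖star (p k t) * p m t‖ ≤ ε := by
    intro k ε hε
    -- first component
    let a : T → M := fun t => star (δ t (e k))
    have ha : Continuous a := continuous_star.comp (hS.δ_cont _ (hS.e_mem k))
    have haS : ∀ t, a t ∈ S := fun t => hS.star_mem _ (hS.δ_mem t _ (hS.e_mem k))
    have hb : Continuous fun t => τ t (a t) := joint_cont τ hT.τ_norm hS.τ_cont a ha haS
    obtain ⟨m1, h1⟩ := hS.uniform_right _ (hK.image ha)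
      (by rintro _ ⟨t, _, rfl⟩; exact haS t) (ε / 4) (by positivity)
    obtain ⟨m2, h2⟩ := hS.uniform_right _ (hK.image hb)
      (by rintro _ ⟨t, _, rfl⟩; exact hS.τ_mem _ _ (haS t)) (ε / 4) (by positivity)
    -- second component
    obtain ⟨a1, ha1, hΦ1⟩ := hS.zr _ (hS.e_mem k)
    obtain ⟨a2, ha2, hΦ2⟩ := hS.zl _ (hS.e_mem k)
    set b := a2 - a1 with hbdef
    have hbS : b ∈ S := S.sub_mem ha2 ha1
    obtain ⟨b', hb'S, hb'⟩ := hS.zr b hbS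
    obtain ⟨m3, h3⟩ := hS.uniform_right {b} isCompact_singleton (by simpa using hbS)
      (ε / (2 * (‖z‖ + 1))) (by positivity)
    obtain ⟨m4, h4⟩ := hS.uniform_right {b'} isCompact_singleton (by simpa using hb'S)
      (ε / 2) (by positivity)
    refine ⟨m1 + m2 + m3 + m4, fun m hm t _ => ?_⟩
    rw [Prod.norm_def]
    refine max_le ?_ ?_
    · rcases t with _ | t
      · simp [p, hε.le]
      · simp only [p, Prod.fst_mul, Prod.fst_star]
        have e1 : star (δ t.1 (e k)) * δ t.1 (e m) = δ t.1 (a t.1 * e m - a t.1)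
            - (δ t.1 (a t.1) * σ t.1 (e m) - δ t.1 (a t.1)) := by
          rw [map_sub, hT.δ_mul]; simp only [a]; noncomm_ring
        rw [e1]
        have i1 := h1 m (by omega) (a t.1) ⟨t.1, t.2, rfl⟩
        have i2 := h2 m (by omega) (τ t.1 (a t.1)) ⟨t.1, t.2, rfl⟩
        have i3 := hT.δ_norm t.1 (a t.1 * e m - a t.1)
        have i4 := hT.tw t.1 (a t.1) (e m)
        have i5 := norm_sub_le (δ t.1 (a t.1 * e m - a t.1)) (δ t.1 (a t.1) * σ t.1 (e m) - δ t.1 (a t.1))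
        linarith
    · simp only [p, Prod.snd_mul, Prod.snd_star]
      have e1 : star (Φ (e k) * z - z * Φ (e k)) = Φ b := by
        rw [hbdef, map_sub, hΦ1, hΦ2, star_sub, star_mul, star_mul, hz, ← map_star, hS.e_star]
      have e2 : Φ b * (Φ (e m) * z - z * Φ (e m)) = Φ (b * e m - b) * z - Φ (b' * e m - b') := by
        rw [map_sub Φ (b * e m), map_sub Φ (b' * e m), map_mul, map_mul, hb']; noncomm_ring
      rw [e1, e2]
      have i1 := h3 m (by omega) b rfl
      have i2 := h4 m (by omega) b' rfl
      have i3 := hom_norm Φ (b * e m - b)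
      have i4 := hom_norm Φ (b' * e m - b')
      have i5 : ‖Φ (b * e m - b) * z‖ ≤ ε / 2 := by
        calc _ ≤ ‖Φ (b * e m - b)‖ * ‖z‖ := norm_mul_le _ _
          _ ≤ (ε / (2 * (‖z‖ + 1))) * (‖z‖ + 1) := by gcongr; exact i3.trans i1; linarith
          _ = ε / 2 := by field_simp
      have i6 := norm_sub_le (Φ (b * e m - b) * z) (Φ (b' * e m - b'))
      linarith
  obtain ⟨s, hs, hsn, hsK⟩ := exists_average p Set.univ _ hpC hp n0 ε hε
  have hcard : (s.card : ℂ) ≠ 0 := by exact_mod_cast hs.card_pos.ne'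
  refine ⟨((s.card : ℂ)⁻¹) • ∑ m ∈ s, e m, ?_, ?_, ?_, ?_, ?_, ?_⟩
  · exact S.smul_mem _ (S.sum_mem fun m _ => hS.e_mem m)
  · rw [star_smul, star_sum]; simp [hS.e_star]
  · apply avg_norm_le s hs
    refine (norm_sum_le _ _).trans ?_
    refine (Finset.sum_le_sum fun m _ => hS.e_norm m).trans ?_
    simp
  · intro t ht
    rw [map_smul, map_sum]
    apply avg_norm_le s hs
    have := hsK (some ⟨t, ht⟩) trivial
    refine le_trans ?_ this
    refine le_trans (le_of_eq ?_) (norm_fst_le _)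
    rw [Prod.fst_sum]
  · have e1 : Φ (((s.card : ℂ)⁻¹) • ∑ m ∈ s, e m) * z - z * Φ (((s.card : ℂ)⁻¹) • ∑ m ∈ s, e m)
      = ((s.card : ℂ)⁻¹) • ∑ m ∈ s, (Φ (e m) * z - z * Φ (e m)) := by
      rw [map_smul, map_sum, Finset.sum_sub_distrib, smul_sub, smul_mul_assoc, mul_smul_comm,
        Finset.sum_mul, Finset.mul_sum]
    rw [e1]
    apply avg_norm_le s hs
    have := hsK none trivial
    refine le_trans ?_ this
    refine le_trans (le_of_eq ?_) (norm_snd_le _)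
    rw [Prod.snd_sum]
  · intro a η h
    have e1 : (((s.card : ℂ)⁻¹) • ∑ m ∈ s, e m) * a - a
      = ((s.card : ℂ)⁻¹) • ∑ m ∈ s, (e m * a - a) := by
      rw [Finset.sum_sub_distrib, smul_sub, smul_mul_assoc, Finset.sum_mul, Finset.sum_const,
        ← Nat.cast_smul_eq_nsmul ℂ, smul_smul, inv_mul_cancel₀ hcard, one_smul]
    rw [e1]
    apply avg_norm_le s hs
    refine (norm_sum_le _ _).trans ?_
    refine (Finset.sum_le_sum fun m hm => h m (hn0 m (hsn m hm))).trans ?_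
    simp [mul_comm]

end
end Tz
end

noncomputable section
open scoped MultiplierAlgebra
open Filter Topology

namespace Tz

/-- The abstract extension setting. -/
structure ExtSys {T M N : Type} [TopologicalSpace T] [CStarAlgebra M] [CStarAlgebra N]
    (δ τ : T → M →ₗ[ℂ] M) (σ : T → M → M) (Φ : M →⋆ₐ[ℂ] N) (z : N)
    (I J : Submodule ℂ M) (e j : ℕ → M) : Prop where
  hT : TestSys δ τ σ
  hz : star z = z
  hI : GoodIdeal δ τ Φ z I e
  hJ : GoodIdeal δ τ Φ z J j
  J_iff : ∀ a, a ∈ J ↔ a ∈ I ∧ Φ a = 0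
  lift : ∀ a ∈ I, star (Φ a) = Φ a → ∃ c ∈ I, star c = c ∧ Φ c = Φ a ∧ ‖c‖ ≤ ‖Φ a‖
  Φδ : ∀ t, ∀ e ∈ I, ∀ c ∈ I, star e = e → Φ c = Φ e * z * Φ e →
    ‖Φ (δ t c)‖ ≤ 2 * ‖z‖ * ‖e‖ * ‖δ t e‖

section
variable {T M N : Type} [TopologicalSpace T] [CStarAlgebra M] [CStarAlgebra N]
    {δ τ : T → M →ₗ[ℂ] M} {σ : T → M → M} {Φ : M →⋆ₐ[ℂ] N} {z : N}
    {I J : Submodule ℂ M} {e j : ℕ → M}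

/-- commutator with `z` as a derivation -/
def commZ (Φ : M →⋆ₐ[ℂ] N) (z : N) : M →ₗ[ℂ] N where
  toFun a := Φ a * z - z * Φ a
  map_add' a b := by rw [map_add]; noncomm_ring
  map_smul' c a := by
    rw [map_smul, smul_mul_assoc, mul_smul_comm, RingHom.id_apply, smul_sub]

lemma ExtSys.exists_hk (h : ExtSys δ τ σ Φ z I J e j) (K : Set T) (hK : IsCompact K)
    (L : Set M) (hL : IsCompact L) (hLI : ∀ a ∈ L, a ∈ I) (ε : ℝ) (hε : 0 < ε) :
    ∃ u k : M, u ∈ I ∧ star u = u ∧ star k = k ∧ u * u + k * k = 1 ∧ ‖u‖ ≤ 1 ∧ ‖k‖ ≤ 1 ∧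
      (∀ t ∈ K, ‖δ t u‖ ≤ ε ∧ ‖δ t k‖ ≤ ε) ∧ ‖Φ u * z - z * Φ u‖ ≤ ε ∧
      ‖Φ k * z - z * Φ k‖ ≤ ε ∧ ∀ a ∈ L, ‖u * a - a‖ ≤ ε ∧ ‖k * a‖ ≤ ε := by
  obtain ⟨v, hvI, hvs, hv1, hvδ, hvz, hvL⟩ := h.hI.kasparov h.hT h.hz K hK
    (fun m => ∀ a ∈ L, ‖e m * a - a‖ ≤ ε / 6)
    (h.hI.uniform_left L hL hLI (ε / 6) (by positivity)) (ε / 6) (by positivity)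
  obtain ⟨w, hws, hw1, h1, h2, hcomm, hk, hu, hsum, hk1, hu1, hka, hua⟩ := Tz.exists_hk v hvs hv1
  have hd : ∀ t ∈ K, ‖δ t (2 • w - 1)‖ ≤ ε ∧ ‖δ t (2 • (w * v))‖ ≤ ε := by
    intro t ht
    have := deriv_hk (δ t) (RingHom.id M) (σ t) (fun a => le_rfl) (h.hT.σ_norm t)
      (fun a b => by simpa using h.hT.δ_mul t a b) (h.hT.δ_one t) hv1 hw1 h1 h2 (hvδ t ht)
    constructor <;> linarith
  have hz := deriv_hk (commZ Φ z) (Φ : M →+* N) Φ (hom_norm Φ) (hom_norm Φ)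
      (fun a b => by simp only [commZ, LinearMap.coe_mk, AddHom.coe_mk, map_mul, RingHom.coe_coe]
                     noncomm_ring)
      (by simp [commZ]) hv1 hw1 h1 h2 (η := ε / 6) hvz
  refine ⟨2 • (w * v), 2 • w - 1, ?_, hu, hk, hsum, hu1, hk1, fun t ht => (hd t ht).symm, ?_, ?_, ?_⟩
  · exact I.smul_of_tower_mem 2 (h.hI.mul_left _ _ hvI)
  · have := hz.2
    simp only [commZ, LinearMap.coe_mk, AddHom.coe_mk] at this
    linarith
  · have := hz.1
    simp only [commZ, LinearMap.coe_mk, AddHom.coe_mk] at this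
    linarith
  · intro a ha
    have i1 := hvL a (ε / 6) (fun m hm => hm a ha)
    have i2 := hka a
    have i3 := hua a
    constructor <;> linarith

/-- lifts of arbitrary elements with norm control mod `J` -/
lemma ExtSys.lift2 (h : ExtSys δ τ σ Φ z I J e j) (a : M) (ha : a ∈ I) :
    ∃ a' ∈ I, a - a' ∈ J ∧ ‖a'‖ ≤ 2 * ‖Φ a‖ := by
  have half : ∀ c : ℂ, ‖c‖ = 1 → ∀ x : N, ‖(2⁻¹ * c) • x‖ = ‖x‖ / 2 := by
    intro c hc x; rw [norm_smul, norm_mul, hc]; norm_num; ring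
  set r : M := (2⁻¹ * 1 : ℂ) • (a + star a) with hr
  set s : M := (2⁻¹ * Complex.I : ℂ) • (star a - a) with hs
  have hrI : r ∈ I := I.smul_mem _ (I.add_mem ha (h.hI.star_mem a ha))
  have hsI : s ∈ I := I.smul_mem _ (I.sub_mem (h.hI.star_mem a ha) ha)
  have hrs : star r = r := by rw [hr, star_smul]; simp [add_comm]
  have hss : star s = s := by
    rw [hs, star_smul]; simp only [star_sub, star_star, star_mul', star_inv₀, star_ofNat]
    rw [show star Complex.I = - Complex.I from Complex.conj_I, mul_neg, neg_smul, ← smul_neg, neg_sub]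
  have hΦr : ‖Φ r‖ ≤ ‖Φ a‖ := by
    rw [hr, map_smul, half _ (by simp), map_add, map_star]
    have := norm_add_le (Φ a) (star (Φ a))
    rw [norm_star] at this
    linarith
  have hΦs : ‖Φ s‖ ≤ ‖Φ a‖ := by
    rw [hs, map_smul, half _ (by simp), map_sub, map_star]
    have := norm_sub_le (star (Φ a)) (Φ a)
    rw [norm_star] at this
    linarith
  have hdec : a = r + Complex.I • s := by
    rw [hr, hs, smul_smul]
    have : Complex.I * (2⁻¹ * Complex.I) = -2⁻¹ := by
      rw [mul_left_comm, Complex.I_mul_I]; ring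
    rw [this, mul_one, neg_smul, ← smul_neg, neg_sub, ← smul_add]
    rw [show a + star a + (a - star a) = (2 : ℂ) • a by rw [two_smul]; abel, smul_smul]
    simp
  obtain ⟨r', hr'I, -, hr'Φ, hr'n⟩ := h.lift r hrI (by rw [← map_star, hrs])
  obtain ⟨s', hs'I, -, hs'Φ, hs'n⟩ := h.lift s hsI (by rw [← map_star, hss])
  refine ⟨r' + Complex.I • s', I.add_mem hr'I (I.smul_mem _ hs'I), ?_, ?_⟩
  · rw [h.J_iff]
    refine ⟨I.sub_mem ha (I.add_mem hr'I (I.smul_mem _ hs'I)), ?_⟩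
    rw [map_sub, map_add, map_smul, hr'Φ, hs'Φ, ← map_smul, ← map_add, ← hdec, sub_self]
  · have := norm_add_le r' (Complex.I • s')
    rw [norm_smul, Complex.norm_I, one_mul] at this
    linarith

lemma ExtSys.exists_c (h : ExtSys δ τ σ Φ z I J e j) (K : Set T) (hK : IsCompact K)
    (b : M) (hb : b ∈ I) (ε : ℝ) (hε : 0 < ε) :
    ∃ c ∈ I, star c = c ∧ ‖c‖ ≤ 4 * ‖z‖ ∧ (∀ t ∈ K, ‖δ t c‖ ≤ ε) ∧ ‖(Φ c - z) * Φ b‖ ≤ ε := by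
  set ε1 := ε / (20 * (‖z‖ + 1)) with hε1
  have hz0 := norm_nonneg z
  have hεonepos : 0 < ε1 := by positivity
  have hεeq : ε = 20 * (‖z‖ + 1) * ε1 := by rw [hε1]; field_simp
  obtain ⟨b2, hb2I, hb2⟩ := h.hI.zl b hb
  obtain ⟨x, hxI, hxs, hx1, hxδ, -, hxL⟩ := h.hI.kasparov h.hT h.hz K hK
    (fun m => ∀ a ∈ ({b, b2} : Set M), ‖e m * a - a‖ ≤ ε1)
    (h.hI.uniform_left {b, b2} (Set.toFinite _).isCompact
      (by rintro a (rfl | rfl); exacts [hb, hb2I]) ε1 hεonepos) ε1 hεonepos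
  have hxb := hxL b ε1 (fun m hm => hm b (by simp))
  have hxb2 := hxL b2 ε1 (fun m hm => hm b2 (by simp))
  obtain ⟨y, hyI, hy⟩ := h.hI.zl x hxI
  have hΦx : ‖Φ x‖ ≤ 1 := (hom_norm Φ x).trans hx1
  have hsΦx : star (Φ x) = Φ x := by rw [← map_star, hxs]
  have hbΦ : Φ (x * y) = Φ x * z * Φ x := by rw [map_mul, hy, mul_assoc]
  obtain ⟨c0, hc0I, hc0s, hc0Φ, hc0n⟩ := h.lift (x * y) (h.hI.mul_left _ _ hyI)
    (by rw [hbΦ]; simp [hsΦx, h.hz, mul_assoc])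
  have hc0n : ‖c0‖ ≤ ‖z‖ := by
    refine hc0n.trans ?_
    rw [hbΦ]
    calc _ ≤ ‖Φ x‖ * ‖z‖ * ‖Φ x‖ := (norm_mul_le _ _).trans (by gcongr; exact norm_mul_le _ _)
      _ ≤ 1 * ‖z‖ * 1 := by gcongr
      _ = ‖z‖ := by ring
  have hδc0 : ∀ t ∈ K, ‖Φ (δ t c0)‖ ≤ 2 * ‖z‖ * ε1 := by
    intro t ht
    refine (h.Φδ t x hxI c0 hc0I hxs (by rw [hc0Φ, hbΦ])).trans ?_
    calc _ ≤ 2 * ‖z‖ * 1 * ε1 := by gcongr; exact hxδ t ht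
      _ = _ := by ring
  -- choose the element of `J`
  set η := ε1 + 8 * ‖z‖ * ε1 + ε1 with hη
  set L := (fun t => δ t c0) '' K with hL
  have hLc : IsCompact L := hK.image (h.hI.δ_cont c0 hc0I)
  have hJn := h.hJ.e_norm
  have hun := compact_uniform (fun m a => ‖j m * a - a‖) L hLc (by
      intro m a b
      have e1 : j m * a - a = (j m * b - b) + (j m * (a - b) - (a - b)) := by noncomm_ring
      rw [e1]
      have h1 : ‖j m * (a - b)‖ ≤ 1 * ‖a - b‖ := (norm_mul_le _ _).trans (by gcongr; exact hJn m)
      have h2 := norm_add_le (j m * b - b) (j m * (a - b) - (a - b))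
      have h3 := norm_sub_le (j m * (a - b)) (a - b)
      linarith) (ε1 + 8 * ‖z‖ * ε1) (by
      rintro _ ⟨t, ht, rfl⟩
      obtain ⟨a', ha'I, ha'J, ha'n⟩ := h.lift2 (δ t c0) (h.hI.δ_mem t c0 hc0I)
      obtain ⟨m0, hm0⟩ := h.hJ.uniform_left {δ t c0 - a'} isCompact_singleton
        (by simpa using ha'J) ε1 hεonepos
      refine ⟨m0, fun m hm => ?_⟩
      have i0 := hm0 m hm _ rfl
      have i1 := hδc0 t ht
      have e1 : j m * (δ t c0) - δ t c0 = (j m * (δ t c0 - a') - (δ t c0 - a')) + (j m * a' - a') := by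
        noncomm_ring
      simp only
      rw [e1]
      have h1 : ‖j m * a'‖ ≤ 1 * ‖a'‖ := (norm_mul_le _ _).trans (by gcongr; exact hJn m)
      have h2 := norm_add_le (j m * (δ t c0 - a') - (δ t c0 - a')) (j m * a' - a')
      have h3 := norm_sub_le (j m * a') a'
      linarith) ε1 hεonepos
  obtain ⟨v, hvJ, hvs, hv1, hvδ, -, hvL⟩ := h.hJ.kasparov h.hT h.hz K hK
    (fun m => ∀ a ∈ L, ‖j m * a - a‖ ≤ η) hun ε1 hεonepos
  have hvI := (h.J_iff v).1 hvJ
  have h1v : ‖1 - v‖ ≤ 2 := by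
    rcases subsingleton_or_nontrivial M with hM | hM
    · rw [Subsingleton.elim (1 - v) 0]; simp
    · have := norm_sub_le 1 v
      rw [norm_one] at this
      linarith
  refine ⟨(1 - v) * (c0 * (1 - v)), h.hI.mul_left _ _ (h.hI.mul_right _ _ hc0I), ?_, ?_, ?_, ?_⟩
  · simp [hvs, hc0s, mul_assoc]
  · calc _ ≤ ‖1 - v‖ * (‖c0‖ * ‖1 - v‖) := (norm_mul_le _ _).trans (by gcongr; exact norm_mul_le _ _)
      _ ≤ 2 * (‖z‖ * 2) := by gcongr
      _ = _ := by ring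
  · intro t ht
    have d1 : δ t (1 - v) = - δ t v := by rw [map_sub, h.hT.δ_one, zero_sub]
    have e1 : δ t ((1 - v) * (c0 * (1 - v))) = - (δ t v * σ t (c0 * (1 - v)))
      + (1 - v) * δ t c0 * σ t (1 - v) - (1 - v) * (c0 * δ t v) := by
      rw [h.hT.δ_mul t (1 - v), h.hT.δ_mul t c0, d1]; noncomm_ring
    have i1 : ‖δ t v * σ t (c0 * (1 - v))‖ ≤ ε1 * (‖z‖ * 2) := by
      refine (norm_mul_le _ _).trans ?_
      gcongr
      · exact hvδ t ht
      · refine (h.hT.σ_norm _ _).trans ((norm_mul_le _ _).trans ?_)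
        gcongr
    have i2 : ‖(1 - v) * δ t c0 * σ t (1 - v)‖ ≤ η * 2 := by
      refine (norm_mul_le _ _).trans ?_
      gcongr
      · have := hvL (δ t c0) η (fun m hm => hm _ ⟨t, ht, rfl⟩)
        rw [← norm_neg] at this
        refine le_trans (le_of_eq ?_) this
        congr 1
        noncomm_ring
      · exact (h.hT.σ_norm _ _).trans h1v
    have i3 : ‖(1 - v) * (c0 * δ t v)‖ ≤ 2 * (‖z‖ * ε1) := by
      refine (norm_mul_le _ _).trans ?_
      gcongr
      refine (norm_mul_le _ _).trans ?_
      gcongr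
      exact hvδ t ht
    rw [e1]
    have j1 := norm_sub_le (- (δ t v * σ t (c0 * (1 - v))) + (1 - v) * δ t c0 * σ t (1 - v))
      ((1 - v) * (c0 * δ t v))
    have j2 := norm_add_le (- (δ t v * σ t (c0 * (1 - v)))) ((1 - v) * δ t c0 * σ t (1 - v))
    rw [norm_neg] at j2
    rw [hεeq]
    rw [hη] at i2
    nlinarith
  · have hΦc : Φ ((1 - v) * (c0 * (1 - v))) = Φ x * z * Φ x := by
      rw [map_mul, map_mul, map_sub, map_one, hvI.2, hc0Φ, hbΦ]; simp
    have e1 : (Φ ((1 - v) * (c0 * (1 - v))) - z) * Φ b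
      = Φ x * z * Φ (x * b - b) + Φ (x * b2 - b2) := by
      rw [hΦc, map_sub, map_sub, map_mul, map_mul, hb2]; noncomm_ring
    rw [e1]
    have i1 : ‖Φ x * z * Φ (x * b - b)‖ ≤ 1 * ‖z‖ * ε1 := by
      refine (norm_mul_le _ _).trans ?_
      gcongr
      · refine (norm_mul_le _ _).trans ?_
        gcongr
      · exact (hom_norm Φ _).trans hxb
    have i2 := (hom_norm Φ _).trans hxb2
    have i3 := norm_add_le (Φ x * z * Φ (x * b - b)) (Φ (x * b2 - b2))
    rw [hεeq]
    nlinarith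

end
end Tz
end

noncomputable section
open scoped MultiplierAlgebra
open Filter Topology

namespace Tz

/-- state of the recursion -/
structure St (M : Type) where
  Q : M
  h : M
  k : M

/-- current approximant -/
def St.P {M : Type} [CStarAlgebra M] (s : St M) : M := s.h * s.Q * s.h

/-- current error -/
def St.E {M N : Type} [CStarAlgebra M] [CStarAlgebra N] (Φ : M →⋆ₐ[ℂ] N) (z : N) (s : St M) : N :=
  Φ s.P - Φ s.h * z * Φ s.h

/-- validity of the state -/
structure Valid {T M N : Type} [CStarAlgebra M] [CStarAlgebra N]
    (δ : T → M →ₗ[ℂ] M) (Φ : M →⋆ₐ[ℂ] N) (z : N)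
    (I : Submodule ℂ M) (e : ℕ → M) (K : ℕ → Set T) (n : ℕ) (s : St M) : Prop where
  Qm : s.Q ∈ I
  Qs : star s.Q = s.Q
  Qn : ‖s.Q‖ ≤ 4 * ‖z‖
  hm : s.h ∈ I
  hs : star s.h = s.h
  ks : star s.k = s.k
  hk : s.h * s.h + s.k * s.k = 1
  hn : ‖s.h‖ ≤ 1
  kn : ‖s.k‖ ≤ 1
  hδ : ∀ t ∈ K n, ‖δ t s.h‖ ≤ (1 / 2 : ℝ) ^ n
  kδ : ∀ t ∈ K n, ‖δ t s.k‖ ≤ (1 / 2 : ℝ) ^ n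
  hz : ‖Φ s.h * z - z * Φ s.h‖ ≤ (1 / 2 : ℝ) ^ n
  kz : ‖Φ s.k * z - z * Φ s.k‖ ≤ (1 / 2 : ℝ) ^ n
  he : ∀ i ≤ n, ‖s.h * e i - e i‖ ≤ (1 / 2 : ℝ) ^ n
  ke : ∀ i ≤ n, ‖s.k * e i‖ ≤ (1 / 2 : ℝ) ^ n

section
variable {T M N : Type} [TopologicalSpace T] [CStarAlgebra M] [CStarAlgebra N]
    {δ τ : T → M →ₗ[ℂ] M} {σ : T → M → M} {Φ : M →⋆ₐ[ℂ] N} {z : N}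
    {I J : Submodule ℂ M} {e j : ℕ → M} {K : ℕ → Set T}

lemma norm_conj_le {R : Type} [NormedRing R] {h Q : R} {C : ℝ} (hC : 0 ≤ C) (hh : ‖h‖ ≤ 1)
    (hQ : ‖Q‖ ≤ C) : ‖h * Q * h‖ ≤ C := by
  calc _ ≤ ‖h‖ * ‖Q‖ * ‖h‖ := (norm_mul_le _ _).trans (by gcongr; exact norm_mul_le _ _)
    _ ≤ 1 * C * 1 := by gcongr
    _ = C := by ring

lemma norm_mul_le_right {R : Type} [NormedRing R] {a b : R} {C : ℝ} (hC : 0 ≤ C) (ha : ‖a‖ ≤ 1)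
    (hb : ‖b‖ ≤ C) : ‖a * b‖ ≤ C := by
  calc _ ≤ ‖a‖ * ‖b‖ := norm_mul_le _ _
    _ ≤ 1 * C := by gcongr
    _ = C := by ring

lemma norm_mul_le_left {R : Type} [NormedRing R] {a b : R} {C : ℝ} (hC : 0 ≤ C) (ha : ‖a‖ ≤ C)
    (hb : ‖b‖ ≤ 1) : ‖a * b‖ ≤ C := by
  calc _ ≤ ‖a‖ * ‖b‖ := norm_mul_le _ _
    _ ≤ C * 1 := by gcongr
    _ = C := by ring

lemma Valid.Pn {n : ℕ} {s : St M} (v : Valid δ Φ z I e K n s) : ‖s.P‖ ≤ 4 * ‖z‖ :=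
  norm_conj_le (by positivity) v.hn v.Qn

lemma Valid.Ps {n : ℕ} {s : St M} (v : Valid δ Φ z I e K n s) : star s.P = s.P := by
  simp [St.P, v.hs, v.Qs, mul_assoc]

lemma ExtSys.Pm (H : ExtSys δ τ σ Φ z I J e j) {n : ℕ} {s : St M}
    (v : Valid δ Φ z I e K n s) : s.P ∈ I := H.hI.mul_left _ _ v.hm

lemma ExtSys.Em (H : ExtSys δ τ σ Φ z I J e j) {n : ℕ} {s : St M}
    (v : Valid δ Φ z I e K n s) : ∃ a ∈ I, Φ a = s.E Φ z := by
  obtain ⟨y, hy, hy2⟩ := H.hI.zl _ v.hm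
  refine ⟨s.P - s.h * y, I.sub_mem (H.Pm v) (H.hI.mul_left _ _ hy), ?_⟩
  rw [St.E, map_sub, map_mul Φ s.h y, hy2, mul_assoc]

lemma ExtSys.start (H : ExtSys δ τ σ Φ z I J e j) (hK : ∀ n, IsCompact (K n)) :
    ∃ s : St M, Valid δ Φ z I e K 0 s := by
  obtain ⟨u, k, h1, h2, h3, h4, h5, h6, h7, h8, h9, h10⟩ := H.exists_hk (K 0) (hK 0) {e 0}
    isCompact_singleton (by simpa using H.hI.e_mem 0) 1 one_pos
  refine ⟨⟨0, u, k⟩, ⟨I.zero_mem, by simp, by simp, h1, h2, h3, h4, h5, h6, ?_, ?_, ?_, ?_, ?_, ?_⟩⟩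
  · simpa using fun t ht => (h7 t ht).1
  · simpa using fun t ht => (h7 t ht).2
  · simpa using h8
  · simpa using h9
  · simpa using (h10 _ rfl).1
  · simpa using (h10 _ rfl).2

lemma ExtSys.step (H : ExtSys δ τ σ Φ z I J e j) (hK : ∀ n, IsCompact (K n))
    (hKm : ∀ n, K n ⊆ K (n + 1)) (n : ℕ) (s : St M) (v : Valid δ Φ z I e K n s) :
    ∃ s' : St M, Valid δ Φ z I e K (n + 1) s' ∧
      (∀ i ≤ n, ‖(s'.P - s.P) * e i‖ ≤ (24 * ‖z‖ + 5) * (1 / 2 : ℝ) ^ n) ∧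
      (∀ t ∈ K n, ‖δ t s'.P - δ t s.P‖ ≤ (24 * ‖z‖ + 5) * (1 / 2 : ℝ) ^ n) ∧
      ‖s'.E Φ z - s.E Φ z‖ ≤ (24 * ‖z‖ + 5) * (1 / 2 : ℝ) ^ n := by
  obtain ⟨E', hE'I, hE'⟩ := H.Em v
  set P := s.P with hP
  have hPI : P ∈ I := H.Pm v
  have hPn : ‖P‖ ≤ 4 * ‖z‖ := v.Pn
  set C := 4 * ‖z‖ with hC
  have hC0 : 0 ≤ C := by positivity
  set ε := (1 / 2 : ℝ) ^ n with hε
  have hε0 : 0 < ε := by positivity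
  set ε' := (1 / 2 : ℝ) ^ (n + 1) with hε'
  have hε'0 : 0 < ε' := by positivity
  have hεε : ε' ≤ ε := by rw [hε', hε, pow_succ]; linarith
  have cδ := H.hI.δ_cont P hPI
  have cτ := H.hI.τ_cont P hPI
  let L : Set M := ((({P, E', star E'} : Set M) ∪ e '' (Set.Iic (n + 1)))
    ∪ ((fun t => δ t P) '' K n)) ∪ ((fun t => star (τ t P)) '' K n)
  have hLc : IsCompact L := by
    refine ((IsCompact.union ?_ ?_).union ?_).union ?_
    · exact (Set.toFinite _).isCompact
    · exact ((Set.finite_Iic _).image _).isCompact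
    · exact (hK n).image cδ
    · exact (hK n).image (continuous_star.comp cτ)
  have hLI : ∀ a ∈ L, a ∈ I := by
    rintro a (((( rfl | rfl | rfl) | ⟨i, -, rfl⟩) | ⟨t, -, rfl⟩) | ⟨t, -, rfl⟩)
    · exact hPI
    · exact hE'I
    · exact H.hI.star_mem _ hE'I
    · exact H.hI.e_mem i
    · exact H.hI.δ_mem t _ hPI
    · exact H.hI.star_mem _ (H.hI.τ_mem t _ hPI)
  obtain ⟨u, w, u1, u2, u3, u4, u5, u6, u7, u8, u9, u10⟩ := H.exists_hk (K (n + 1)) (hK (n + 1)) L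
    hLc hLI ε' hε'0
  have uP := (u10 P (Or.inl (Or.inl (Or.inl (by simp))))).1
  have uE := (u10 E' (Or.inl (Or.inl (Or.inl (by simp))))).1
  have uEs := (u10 (star E') (Or.inl (Or.inl (Or.inl (by simp))))).1
  have ue := fun i (hi : i ≤ n + 1) => (u10 (e i) (Or.inl (Or.inl (Or.inr ⟨i, hi, rfl⟩))))
  have uδ := fun t (ht : t ∈ K n) => (u10 (δ t P) (Or.inl (Or.inr ⟨t, ht, rfl⟩))).1
  have uτ := fun t (ht : t ∈ K n) => (u10 (star (τ t P)) (Or.inr ⟨t, ht, rfl⟩)).1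
  obtain ⟨c, cI, cs, cn, cδ, cz⟩ := H.exists_c (K n) (hK n) (s.k * u) (H.hI.mul_left _ _ u1) ε hε0
  rw [← hC] at cn
  have hn := v.hn
  have kn := v.kn
  have knΦ := (hom_norm Φ s.k).trans v.kn
  have hnΦ := (hom_norm Φ s.h).trans v.hn
  have unΦ := (hom_norm Φ u).trans u5
  set Q' := P + s.k * c * s.k with hQ'
  have hs'P : ({ Q := Q', h := u, k := w } : St M).P = u * P * u + u * s.k * c * (s.k * u) := by
    simp only [St.P, hQ']; noncomm_ring
  refine ⟨⟨Q', u, w⟩, ⟨?_, ?_, ?_, u1, u2, u3, u4, u5, u6, fun t ht => (u7 t ht).1,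
    fun t ht => (u7 t ht).2, u8, u9, fun i hi => (ue i hi).1, fun i hi => (ue i hi).2⟩, ?_, ?_, ?_⟩
  · exact I.add_mem hPI (H.hI.mul_right _ _ (H.hI.mul_left _ _ cI))
  · simp only [hQ', star_add, star_mul, v.ks, cs]
    rw [hP, v.Ps, mul_assoc]
  · exact norm_conj_add_le hC0 v.Qs cs v.hs v.ks v.hk v.Qn cn
  · intro i hi
    rw [hs'P]
    have e1 : (u * P * u + u * s.k * c * (s.k * u) - P) * e i
      = u * (P * (u * e i - e i)) + (u * P - P) * e i
        + u * (s.k * (c * (s.k * (u * e i - e i) + s.k * e i))) := by noncomm_ring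
    rw [e1]
    have f1 := (ue i (by omega)).1
    have f2 := v.ke i hi
    have f3 : ‖P * (u * e i - e i)‖ ≤ C * ε' := (norm_mul_le _ _).trans (by gcongr)
    have f4 : ‖u * (P * (u * e i - e i))‖ ≤ C * ε' := norm_mul_le_right (by positivity) u5 f3
    have f5 : ‖(u * P - P) * e i‖ ≤ ε' := norm_mul_le_left hε'0.le uP (H.hI.e_norm i)
    have f6 : ‖s.k * (u * e i - e i)‖ ≤ ε' := norm_mul_le_right hε'0.le kn f1
    have f7 : ‖c * (s.k * (u * e i - e i) + s.k * e i)‖ ≤ C * (ε' + ε) :=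
      (norm_mul_le _ _).trans (by gcongr; exact (norm_add_le _ _).trans (add_le_add f6 f2))
    have f8 := norm_mul_le_right (by positivity) u5 (norm_mul_le_right (by positivity) kn f7)
    have f9 := norm_add₃_le (a := u * (P * (u * e i - e i))) (b := (u * P - P) * e i)
      (c := u * (s.k * (c * (s.k * (u * e i - e i) + s.k * e i))))
    have g1 : C * ε' ≤ C * ε := by gcongr
    have g2 : 0 ≤ C * ε := by positivity
    have g3 : (24 * ‖z‖ + 5) * ε = 6 * (C * ε) + 5 * ε := by rw [hC]; ring
    rw [g3]
    linarith
  · intro t ht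
    have ht' := hKm n ht
    have du : ‖δ t u‖ ≤ ε := (u7 t ht').1.trans hεε
    have dk := v.kδ t ht
    have dc := cδ t ht
    rw [hs'P, map_add]
    have uk1 : ‖u * s.k‖ ≤ 1 := norm_mul_le_right one_pos.le u5 kn
    have ku1 : ‖s.k * u‖ ≤ 1 := norm_mul_le_right one_pos.le kn u5
    have duk : ‖δ t (u * s.k)‖ ≤ ε * 1 + 1 * ε := (H.hT.norm_mul_le t _ _).trans (by gcongr)
    have dku : ‖δ t (s.k * u)‖ ≤ ε * 1 + 1 * ε := (H.hT.norm_mul_le t _ _).trans (by gcongr)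
    have duc : ‖δ t (u * s.k * c)‖ ≤ (ε * 1 + 1 * ε) * C + 1 * ε :=
      (H.hT.norm_mul_le t _ _).trans (by gcongr)
    have nuc : ‖u * s.k * c‖ ≤ C := norm_mul_le_right hC0 uk1 cn
    have d1 : ‖δ t (u * s.k * c * (s.k * u))‖ ≤ ((ε * 1 + 1 * ε) * C + 1 * ε) * 1
        + C * (ε * 1 + 1 * ε) :=
      (H.hT.norm_mul_le t _ _).trans (by gcongr)
    have e1 : δ t (u * P * u) - δ t P = δ t u * σ t (P * u) + u * (P * δ t u)
      + (u * (δ t P * σ t u - δ t P) + (u * δ t P - δ t P)) := by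
      rw [mul_assoc, H.hT.δ_mul t u, H.hT.δ_mul t P]; noncomm_ring
    have nPu : ‖P * u‖ ≤ C := norm_mul_le_left hC0 hPn u5
    have f1 : ‖δ t u * σ t (P * u)‖ ≤ ε * C := (norm_mul_le _ _).trans (by
      gcongr; exact (H.hT.σ_norm t _).trans nPu)
    have f2 : ‖u * (P * δ t u)‖ ≤ C * ε := norm_mul_le_right (by positivity) u5
      ((norm_mul_le _ _).trans (by gcongr))
    have f3 : ‖τ t P * u - τ t P‖ ≤ ε' := by
      have := uτ t ht
      rw [← norm_star] at this
      simpa [u2] using this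
    have f4 : ‖u * (δ t P * σ t u - δ t P)‖ ≤ ε' :=
      norm_mul_le_right hε'0.le u5 ((H.hT.tw t P u).trans f3)
    have f5 := uδ t ht
    have g1 := norm_add_le (u * (δ t P * σ t u - δ t P)) (u * δ t P - δ t P)
    have g2 := norm_add₃_le (a := δ t u * σ t (P * u)) (b := u * (P * δ t u))
      (c := u * (δ t P * σ t u - δ t P) + (u * δ t P - δ t P))
    rw [← e1] at g2
    have g4 := norm_add_le (δ t (u * P * u) - δ t P) (δ t (u * s.k * c * (s.k * u)))
    rw [show δ t (u * P * u) + δ t (u * s.k * c * (s.k * u)) - δ t P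
      = (δ t (u * P * u) - δ t P) + (δ t (u * s.k * c * (s.k * u))) by abel]
    have g3 : (24 * ‖z‖ + 5) * ε = 6 * (C * ε) + 5 * ε := by rw [hC]; ring
    rw [g3]
    linarith
  · have e0 : z = z * (Φ s.h * Φ s.h + Φ s.k * Φ s.k) := by
      rw [← map_mul, ← map_mul, ← map_add, v.hk, map_one, mul_one]
    have e1 : Φ Q' - z = Φ E' + Φ s.k * (Φ c - z) * Φ s.k
        + ((Φ s.h * z - z * Φ s.h) * Φ s.h + (Φ s.k * z - z * Φ s.k) * Φ s.k) := by
      nth_rewrite 1 [e0]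
      rw [hE', hQ', St.E]
      simp only [map_add, map_mul]
      noncomm_ring
    have e2 : ({ Q := Q', h := u, k := w } : St M).E Φ z - s.E Φ z
      = Φ (u * (E' * u - E') + (u * E' - E')) + Φ u * (Φ s.k * ((Φ c - z) * Φ (s.k * u)))
        + Φ u * ((Φ s.h * z - z * Φ s.h) * Φ s.h + (Φ s.k * z - z * Φ s.k) * Φ s.k) * Φ u := by
      have : ({ Q := Q', h := u, k := w } : St M).E Φ z = Φ u * (Φ Q' - z) * Φ u := by
        simp only [St.E, St.P, map_mul]; noncomm_ring
      rw [this, e1, ← hE']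
      simp only [map_add, map_mul, map_sub]
      noncomm_ring
    have f3 : ‖E' * u - E'‖ ≤ ε' := by
      rw [← norm_star] at uEs
      simpa [u2] using uEs
    have f4 : ‖u * (E' * u - E') + (u * E' - E')‖ ≤ ε' + ε' :=
      (norm_add_le _ _).trans (add_le_add (norm_mul_le_right hε'0.le u5 f3) uE)
    have f5 := (hom_norm Φ _).trans f4
    have f6 := norm_mul_le_right hε0.le unΦ (norm_mul_le_right hε0.le knΦ cz)
    have f7 : ‖(Φ s.h * z - z * Φ s.h) * Φ s.h + (Φ s.k * z - z * Φ s.k) * Φ s.k‖ ≤ ε + ε :=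
      (norm_add_le _ _).trans (add_le_add (norm_mul_le_left hε0.le v.hz hnΦ)
        (norm_mul_le_left hε0.le v.kz knΦ))
    have f8 := norm_conj_le (by positivity) unΦ f7
    rw [e2]
    have g2 := norm_add₃_le (a := Φ (u * (E' * u - E') + (u * E' - E')))
      (b := Φ u * (Φ s.k * ((Φ c - z) * Φ (s.k * u))))
      (c := Φ u * ((Φ s.h * z - z * Φ s.h) * Φ s.h + (Φ s.k * z - z * Φ s.k) * Φ s.k) * Φ u)
    have g3 : (24 * ‖z‖ + 5) * ε = 6 * (C * ε) + 5 * ε := by rw [hC]; ring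
    have g4 : 0 ≤ C * ε := by positivity
    rw [g3]
    linarith

end
end Tz
end

noncomputable section
open scoped MultiplierAlgebra
open Filter Topology

namespace Tz

lemma geom_cauchy {R : Type} [NormedAddCommGroup R] (f : ℕ → R) (A : ℝ) (n0 : ℕ)
    (hf : ∀ n ≥ n0, ‖f (n + 1) - f n‖ ≤ A * (1 / 2 : ℝ) ^ n) : CauchySeq f := by
  rw [← cauchySeq_shift n0]
  refine cauchySeq_of_le_geometric (1 / 2) (A * (1 / 2 : ℝ) ^ n0) (by norm_num) fun n => ?_
  rw [dist_comm, dist_eq_norm]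
  have := hf (n + n0) (by omega)
  rw [show n + 1 + n0 = n + n0 + 1 by omega]
  refine this.trans (le_of_eq ?_)
  rw [pow_add]; ring

lemma geom_bound {R : Type} [NormedAddCommGroup R] (f : ℕ → R) (A : ℝ) (n0 : ℕ)
    (hf : ∀ n ≥ n0, ‖f (n + 1) - f n‖ ≤ A * (1 / 2 : ℝ) ^ n) (a : R) (ha : Tendsto f atTop (𝓝 a))
    (n : ℕ) (hn : n0 ≤ n) : ‖f n - a‖ ≤ 2 * A * (1 / 2 : ℝ) ^ n := by
  have := dist_le_of_le_geometric_of_tendsto₀ (1 / 2) (A * (1 / 2 : ℝ) ^ n) (by norm_num)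
    (f := fun m => f (m + n)) (fun m => by
      rw [dist_comm, dist_eq_norm]
      have := hf (m + n) (by omega)
      rw [show m + 1 + n = m + n + 1 by omega]
      refine this.trans (le_of_eq ?_)
      rw [pow_add]; ring) ((tendsto_add_atTop_iff_nat n).2 ha)
  rw [dist_eq_norm] at this
  simp only [zero_add] at this
  refine this.trans (le_of_eq ?_)
  ring

section
variable {T M N : Type} [TopologicalSpace T] [CStarAlgebra M] [CStarAlgebra N]
    {δ τ : T → M →ₗ[ℂ] M} {σ : T → M → M} {Φ : M →⋆ₐ[ℂ] N} {z : N}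
    {I J : Submodule ℂ M} {e j : ℕ → M} {K : ℕ → Set T}

lemma GoodIdeal.cauchy_of (hS : GoodIdeal δ τ Φ z I e) (P : ℕ → M) (C : ℝ) (hP : ∀ n, ‖P n‖ ≤ C)
    (h : ∀ i, CauchySeq fun n => P n * e i) (a : M) (ha : a ∈ I) : CauchySeq fun n => P n * a := by
  have hC : 0 ≤ C := (norm_nonneg _).trans (hP 0)
  rw [Metric.cauchySeq_iff]
  intro ε hε
  obtain ⟨i, hi⟩ := hS.uniform_left {a} isCompact_singleton (by simpa using ha)
    (ε / (4 * (C + 1))) (by positivity)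
  have hi := hi i le_rfl a rfl
  obtain ⟨m0, hm0⟩ := Metric.cauchySeq_iff.1 (h i) (ε / (2 * (‖a‖ + 1))) (by positivity)
  refine ⟨m0, fun m hm n hn => ?_⟩
  have h1 := hm0 m hm n hn
  rw [dist_eq_norm] at h1 ⊢
  have e1 : P m * a - P n * a = (P m * e i - P n * e i) * a - (P m - P n) * (e i * a - a) := by
    noncomm_ring
  rw [e1]
  have i1 : ‖(P m * e i - P n * e i) * a‖ ≤ ε / (2 * (‖a‖ + 1)) * ‖a‖ :=
    (norm_mul_le _ _).trans (by gcongr)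
  have i2 : ‖(P m - P n) * (e i * a - a)‖ ≤ (C + C) * (ε / (4 * (C + 1))) :=
    (norm_mul_le _ _).trans (by gcongr; exact (norm_sub_le _ _).trans (add_le_add (hP m) (hP n)))
  have i3 : ε / (2 * (‖a‖ + 1)) * ‖a‖ < ε / 2 := by
    have : ε / (2 * (‖a‖ + 1)) * ‖a‖ = ε / 2 * (‖a‖ / (‖a‖ + 1)) := by field_simp
    rw [this]
    have : ‖a‖ / (‖a‖ + 1) < 1 := by rw [div_lt_one (by positivity)]; linarith
    nlinarith
  have i4 : (C + C) * (ε / (4 * (C + 1))) ≤ ε / 2 := by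
    have : (C + C) * (ε / (4 * (C + 1))) = ε / 2 * (C / (C + 1)) := by field_simp; ring
    rw [this]
    have : C / (C + 1) ≤ 1 := by rw [div_le_one (by positivity)]; linarith
    nlinarith
  have := norm_sub_le ((P m * e i - P n * e i) * a) ((P m - P n) * (e i * a - a))
  linarith

lemma GoodIdeal.tendsto_of (hS : GoodIdeal δ τ Φ z I e) (h : ℕ → M) (hn : ∀ n, ‖h n‖ ≤ 1)
    (hh : ∀ n, ∀ i ≤ n, ‖h n * e i - e i‖ ≤ (1 / 2 : ℝ) ^ n) (a : M) (ha : a ∈ I) :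
    Tendsto (fun n => h n * a) atTop (𝓝 a) := by
  rw [Metric.tendsto_atTop]
  intro ε hε
  obtain ⟨i, hi⟩ := hS.uniform_left {a} isCompact_singleton (by simpa using ha)
    (ε / 8) (by positivity)
  have hi := hi i le_rfl a rfl
  obtain ⟨m0, hm0⟩ := exists_pow_lt_of_lt_one (show 0 < ε / (2 * (‖a‖ + 1)) by positivity)
    (show (1 / 2 : ℝ) < 1 by norm_num)
  refine ⟨max i m0, fun n hn' => ?_⟩
  have h1 := hh n i (by omega)
  have h2 : (1 / 2 : ℝ) ^ n ≤ (1 / 2 : ℝ) ^ m0 :=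
    pow_le_pow_of_le_one (by norm_num) (by norm_num) (by omega)
  rw [dist_eq_norm]
  have e1 : h n * a - a = (h n * e i - e i) * a - h n * (e i * a - a) + (e i * a - a) := by
    noncomm_ring
  rw [e1]
  have i1 : ‖(h n * e i - e i) * a‖ ≤ ε / (2 * (‖a‖ + 1)) * ‖a‖ :=
    (norm_mul_le _ _).trans (by gcongr; linarith)
  have i2 : ‖h n * (e i * a - a)‖ ≤ ε / 8 := norm_mul_le_right (by positivity) (hn n) hi
  have i3 : ε / (2 * (‖a‖ + 1)) * ‖a‖ ≤ ε / 2 := by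
    have : ε / (2 * (‖a‖ + 1)) * ‖a‖ = ε / 2 * (‖a‖ / (‖a‖ + 1)) := by field_simp
    rw [this]
    have : ‖a‖ / (‖a‖ + 1) ≤ 1 := by rw [div_le_one (by positivity)]; linarith
    nlinarith
  have j1 := norm_sub_le ((h n * e i - e i) * a) (h n * (e i * a - a))
  have j2 := norm_add_le ((h n * e i - e i) * a - h n * (e i * a - a)) (e i * a - a)
  linarith

lemma ExtSys.main (H : ExtSys δ τ σ Φ z I J e j) (hK : ∀ n, IsCompact (K n))
    (hKm : ∀ n, K n ⊆ K (n + 1)) (hIc : IsClosed (I : Set M))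
    (hcomp : ∀ P : ℕ → M, (∀ a ∈ I, CauchySeq fun n => P n * a) →
      (∀ a ∈ I, CauchySeq fun n => a * P n) →
      ∃ y : M, ∀ a ∈ I, Tendsto (fun n => P n * a) atTop (𝓝 (y * a)))
    (essσ : ∀ t m, (∀ b ∈ I, m * σ t b = 0) → m = 0)
    (essN : ∀ n : N, (∀ b ∈ I, n * Φ b = 0) → n = 0)
    (hΦI : IsClosed (Φ '' (I : Set M))) :
    ∃ y : M, Φ y = z ∧ (∀ n, ∀ t ∈ K n, δ t y ∈ I) ∧
      ∀ n, ContinuousOn (fun t => δ t y) (K n) := by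
  obtain ⟨s0, hs0⟩ := H.start hK
  choose! g hg1 hg2 hg3 hg4 using H.step hK hKm
  let f : ℕ → St M := fun n => Nat.rec s0 (fun n s => g n s) n
  have hf : ∀ n, f (n + 1) = g n (f n) := fun n => rfl
  have hv : ∀ n, Valid δ Φ z I e K n (f n) := by
    intro n
    induction n with
    | zero => exact hs0
    | succ n ih => rw [hf]; exact hg1 n _ ih
  have hKmono : Monotone K := monotone_nat_of_le_succ hKm
  set A := 24 * ‖z‖ + 5 with hA
  have r1 : ∀ n, ∀ i ≤ n, ‖((f (n + 1)).P - (f n).P) * e i‖ ≤ A * (1 / 2 : ℝ) ^ n :=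
    fun n => hg2 n _ (hv n)
  have r2 : ∀ n, ∀ t ∈ K n, ‖δ t (f (n + 1)).P - δ t (f n).P‖ ≤ A * (1 / 2 : ℝ) ^ n :=
    fun n => hg3 n _ (hv n)
  have r3 : ∀ n, ‖(f (n + 1)).E Φ z - (f n).E Φ z‖ ≤ A * (1 / 2 : ℝ) ^ n :=
    fun n => hg4 n _ (hv n)
  have c1 : ∀ a ∈ I, CauchySeq fun n => (f n).P * a := by
    refine H.hI.cauchy_of _ (4 * ‖z‖) (fun n => (hv n).Pn) fun i => ?_
    refine geom_cauchy _ A i fun n hn => ?_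
    rw [← sub_mul]
    exact r1 n i hn
  have c2 : ∀ a ∈ I, CauchySeq fun n => a * (f n).P := by
    intro a ha
    have := (starₗᵢ ℂ (E := M)).isometry.uniformContinuous.comp_cauchySeq
      (c1 _ (H.hI.star_mem a ha))
    have e1 : (fun n => a * (f n).P) = ⇑(starₗᵢ ℂ (E := M)) ∘ fun n => (f n).P * star a := by
      funext n
      simp [(hv n).Ps]
    rw [e1]
    exact this
  obtain ⟨y, hy⟩ := hcomp _ c1 c2
  -- the derivations
  have dcont : ∀ t, Continuous (δ t) := fun t =>
    AddMonoidHomClass.continuous_of_bound (δ t) 2 (H.hT.δ_norm t)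
  have d1 : ∀ m, ∀ t ∈ K m, Tendsto (fun n => δ t (f n).P) atTop (𝓝 (δ t y)) := by
    intro m t ht
    have hc : CauchySeq (fun n => δ t (f n).P) :=
      geom_cauchy _ A m fun n hn => r2 n t (hKmono hn ht)
    obtain ⟨l, hl⟩ := cauchySeq_tendsto_of_complete hc
    have : δ t y - l = 0 := by
      apply essσ t
      intro b hb
      have t1 : Tendsto (fun n => δ t (f n).P * σ t b) atTop (𝓝 (l * σ t b)) := hl.mul_const _
      have t2 : Tendsto (fun n => δ t ((f n).P * b) - (f n).P * δ t b) atTop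
          (𝓝 (δ t (y * b) - y * δ t b)) :=
        (((dcont t).tendsto _).comp (hy b hb)).sub (hy _ (H.hI.δ_mem t b hb))
      have t3 : (fun n => δ t ((f n).P * b) - (f n).P * δ t b) = fun n => δ t (f n).P * σ t b := by
        funext n; rw [H.hT.δ_mul]; simp
      rw [t3] at t2
      have := tendsto_nhds_unique t1 t2
      rw [H.hT.δ_mul, add_sub_cancel_right] at this
      rw [sub_mul, this, sub_self]
    rw [sub_eq_zero.1 this]; exact hl
  have d2 : ∀ m, ∀ t ∈ K m, δ t y ∈ I := fun m t ht =>
    hIc.mem_of_tendsto (d1 m t ht) (Eventually.of_forall fun n => H.hI.δ_mem t _ (H.Pm (hv n)))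
  have d3 : ∀ m, ContinuousOn (fun t => δ t y) (K m) := by
    intro m
    have hu : TendstoUniformlyOn (fun n t => δ t (f n).P) (fun t => δ t y) atTop (K m) := by
      rw [Metric.tendstoUniformlyOn_iff]
      intro ε hε
      obtain ⟨m0, hm0⟩ := exists_pow_lt_of_lt_one (show 0 < ε / (2 * A) by positivity)
        (show (1 / 2 : ℝ) < 1 by norm_num)
      filter_upwards [eventually_ge_atTop (max m m0)] with n hn t ht
      have := geom_bound _ A m (fun n hn => r2 n t (hKmono hn ht)) _ (d1 m t ht) n (by omega)
      rw [dist_comm, dist_eq_norm]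
      have h2 : (1 / 2 : ℝ) ^ n ≤ (1 / 2 : ℝ) ^ m0 :=
        pow_le_pow_of_le_one (by norm_num) (by norm_num) (by omega)
      have h3 := h2.trans_lt hm0
      rw [lt_div_iff₀ (by positivity)] at h3
      linarith
    exact hu.continuousOn (Frequently.of_forall fun n =>
      (H.hI.δ_cont _ (H.Pm (hv n))).continuousOn)
  -- the error
  obtain ⟨E, hE⟩ := cauchySeq_tendsto_of_complete
    (geom_cauchy (fun n => (f n).E Φ z) A 0 fun n _ => r3 n)
  have hEI : E ∈ Φ '' (I : Set M) := hΦI.mem_of_tendsto hE (Eventually.of_forall fun n => by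
    obtain ⟨a, ha, ha'⟩ := H.Em (hv n)
    exact ⟨a, ha, ha'⟩)
  obtain ⟨aE, haE, haE'⟩ := hEI
  have hh := H.hI.tendsto_of (fun n => (f n).h) (fun n => (hv n).hn) (fun n => (hv n).he)
  have Φc : Continuous Φ := AddMonoidHomClass.continuous_of_bound Φ 1 (by simpa using hom_norm Φ)
  have hΦy : Φ y - E - z = 0 := by
    apply essN
    intro b hb
    obtain ⟨b', hb'I, hb'⟩ := H.hI.zl b hb
    have t1 : Tendsto (fun n => Φ ((f n).P * b)) atTop (𝓝 (Φ (y * b))) :=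
      (Φc.tendsto _).comp (hy b hb)
    have t2 : Tendsto (fun n => Φ ((f n).h * b')) atTop (𝓝 (Φ b')) :=
      (Φc.tendsto _).comp (hh b' hb'I)
    have t3 : Tendsto (fun n => Φ ((f n).h * b) - Φ b) atTop (𝓝 0) := by
      have := ((Φc.tendsto _).comp (hh b hb)).sub_const (Φ b)
      simpa using this
    have t4 : Tendsto (fun n => Φ (f n).h * z * (Φ ((f n).h * b) - Φ b)) atTop (𝓝 0) := by
      refine squeeze_zero_norm (a := fun n => ‖z‖ * ‖Φ ((f n).h * b) - Φ b‖) (fun n => ?_) ?_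
      · refine (norm_mul_le _ _).trans ?_
        gcongr
        exact norm_mul_le_right (norm_nonneg _) ((hom_norm Φ _).trans (hv n).hn) le_rfl
      · simpa using t3.norm.const_mul ‖z‖
    have t5 := ((hE.mul_const (Φ b)).add t4).add t2
    have t6 : (fun n => (f n).E Φ z * Φ b + Φ (f n).h * z * (Φ ((f n).h * b) - Φ b)
        + Φ ((f n).h * b')) = fun n => Φ ((f n).P * b) := by
      funext n
      rw [map_mul Φ _ b', hb', map_mul Φ _ b, map_mul Φ _ b, St.E]
      noncomm_ring
    rw [t6] at t5
    have := tendsto_nhds_unique t1 t5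
    rw [sub_mul, sub_mul, ← map_mul, this, hb']
    noncomm_ring
  refine ⟨y - aE, ?_, ?_, ?_⟩
  · rw [map_sub, haE']; exact sub_eq_zero.1 hΦy
  · intro m t ht
    rw [map_sub]; exact I.sub_mem (d2 m t ht) (H.hI.δ_mem t _ haE)
  · intro m
    simp only [map_sub]
    exact (d3 m).sub (H.hI.δ_cont _ haE).continuousOn

end
end Tz
end

noncomputable section
open scoped MultiplierAlgebra
open Filter Topology

namespace Tz

section
variable {A B : Type} [NonUnitalCStarAlgebra A] [NonUnitalCStarAlgebra B]

lemma norm_coe (a : A) : ‖(a : 𝓜(ℂ, A))‖ = ‖a‖ := by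
  rw [← DoubleCentralizer.norm_fst, DoubleCentralizer.coe_fst, ContinuousLinearMap.opNorm_mul_apply]

lemma mul_coe (m : 𝓜(ℂ, A)) (a : A) : m * (a : 𝓜(ℂ, A)) = ((m.fst a : A) : 𝓜(ℂ, A)) := by
  apply DoubleCentralizer.ext
  have hf : ∀ b, m.fst (a * b) = m.fst a * b := by
    intro b
    have key : ∀ c : A, c * (m.fst (a * b) - m.fst a * b) = 0 := by
      intro c
      rw [mul_sub, ← m.central, ← mul_assoc, ← mul_assoc, ← m.central, sub_self]
    have := key (star (m.fst (a * b) - m.fst a * b))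
    rw [CStarRing.star_mul_self_eq_zero_iff] at this
    exact sub_eq_zero.1 this
  refine Prod.ext ?_ ?_
  · ext b; simpa using hf b
  · ext b; simpa using m.central b a

lemma coe_star (a : A) : ((star a : A) : 𝓜(ℂ, A)) = star (a : 𝓜(ℂ, A)) :=
  map_star (DoubleCentralizer.coeHom (𝕜 := ℂ) (A := A)) a
lemma coe_add (a b : A) : ((a + b : A) : 𝓜(ℂ, A)) = (a : 𝓜(ℂ, A)) + (b : 𝓜(ℂ, A)) :=
  map_add (DoubleCentralizer.coeHom (𝕜 := ℂ) (A := A)) a b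
lemma coe_sub (a b : A) : ((a - b : A) : 𝓜(ℂ, A)) = (a : 𝓜(ℂ, A)) - (b : 𝓜(ℂ, A)) :=
  map_sub (DoubleCentralizer.coeHom (𝕜 := ℂ) (A := A)) a b
lemma coe_mul (a b : A) : ((a * b : A) : 𝓜(ℂ, A)) = (a : 𝓜(ℂ, A)) * (b : 𝓜(ℂ, A)) :=
  map_mul (DoubleCentralizer.coeHom (𝕜 := ℂ) (A := A)) a b
lemma coe_smul (c : ℂ) (b : A) : ((c • b : A) : 𝓜(ℂ, A)) = c • (b : 𝓜(ℂ, A)) :=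
  map_smul (DoubleCentralizer.coeHom (𝕜 := ℂ) (A := A)) c b
lemma coe_zero : ((0 : A) : 𝓜(ℂ, A)) = 0 :=
  map_zero (DoubleCentralizer.coeHom (𝕜 := ℂ) (A := A))

lemma coe_isometry : Isometry (fun a : A => (a : 𝓜(ℂ, A))) := by
  refine Isometry.of_dist_eq fun a b => ?_
  rw [dist_eq_norm, dist_eq_norm, ← coe_sub, norm_coe]

lemma coe_inj {a b : A} (h : (a : 𝓜(ℂ, A)) = (b : 𝓜(ℂ, A))) : a = b := coe_isometry.injective h

lemma coe_mul_ex (m : 𝓜(ℂ, A)) (a : A) : (a : 𝓜(ℂ, A)) * m = ((m.snd a : A) : 𝓜(ℂ, A)) := by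
  have := congrArg star (mul_coe (star m) (star a))
  rw [star_mul, star_star, ← coe_star, star_star, ← coe_star, DoubleCentralizer.star_fst,
    star_star, star_star] at this
  exact this

lemma ess (m : 𝓜(ℂ, A)) (h : ∀ a : A, m * (a : 𝓜(ℂ, A)) = 0) : m = 0 := by
  rw [← norm_eq_zero, ← DoubleCentralizer.norm_fst, norm_eq_zero]
  ext a
  apply coe_inj
  rw [← mul_coe, h]; simp [coe_zero]

lemma cauchySeq_of_isometry {f : ℕ → A} (h : CauchySeq fun n => (f n : 𝓜(ℂ, A))) :
    CauchySeq f := by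
  rw [Metric.cauchySeq_iff] at h ⊢
  simpa only [coe_isometry.dist_eq] using h

lemma strict_complete (P : ℕ → 𝓜(ℂ, A)) (h1 : ∀ a : A, CauchySeq fun n => P n * (a : 𝓜(ℂ, A)))
    (h2 : ∀ a : A, CauchySeq fun n => (a : 𝓜(ℂ, A)) * P n) :
    ∃ y : 𝓜(ℂ, A), ∀ a : A, Tendsto (fun n => P n * (a : 𝓜(ℂ, A))) atTop (𝓝 (y * (a : 𝓜(ℂ, A)))) := by
  have g1 : ∀ a : A, ∃ l, Tendsto (fun n => (P n).fst a) atTop (𝓝 l) := by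
    intro a
    apply cauchySeq_tendsto_of_complete
    have := h1 a
    simp only [mul_coe] at this
    exact (cauchySeq_of_isometry this)
  have g2 : ∀ a : A, ∃ l, Tendsto (fun n => (P n).snd a) atTop (𝓝 l) := by
    intro a
    apply cauchySeq_tendsto_of_complete
    have := h2 a
    simp only [coe_mul_ex] at this
    exact (cauchySeq_of_isometry this)
  choose f hf using g1
  choose g hg using g2
  let F : A →L[ℂ] A := continuousLinearMapOfTendsto (fun n => (P n).fst) (f := f)
    (tendsto_pi_nhds.2 hf)
  let G : A →L[ℂ] A := continuousLinearMapOfTendsto (fun n => (P n).snd) (f := g)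
    (tendsto_pi_nhds.2 hg)
  have hF : ∀ a, F a = f a := fun a => rfl
  have hG : ∀ a, G a = g a := fun a => rfl
  refine ⟨⟨(F, G), fun x y => ?_⟩, fun a => ?_⟩
  · change G x * y = x * F y
    rw [hF, hG]
    refine tendsto_nhds_unique ((hg x).mul_const y) ?_
    simp only [(P _).central]
    exact (hf y).const_mul x
  · simp only [mul_coe]
    change Tendsto _ _ (𝓝 ((F a : A) : 𝓜(ℂ, A)))
    rw [hF]
    exact (coe_isometry.continuous.tendsto _).comp (hf a)

/-- clamping function -/
def clamp (r x : ℝ) : ℝ := max (-r) (min r x)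

lemma exists_lift (π : A →⋆ₙₐ[ℂ] B) (a : A) (ha : star (π a) = π a) :
    ∃ c : A, star c = c ∧ π c = π a ∧ ‖c‖ ≤ ‖π a‖ := by
  let b : A := (2⁻¹ : ℂ) • (a + star a)
  have hb : IsSelfAdjoint b := by
    simp only [b, IsSelfAdjoint, star_smul, star_add, star_star, add_comm]; simp
  have hπb : π b = π a := by
    simp only [b, map_smul, map_add, map_star, ha]
    rw [← two_smul ℂ, smul_smul]; simp
  set r := ‖π a‖ with hr
  have hr0 : 0 ≤ r := norm_nonneg _
  have hcl : Continuous (clamp r) := by unfold clamp; fun_prop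
  have hcl0 : clamp r 0 = 0 := by simp [clamp, hr0]
  have πc : Continuous π := AddMonoidHomClass.continuous_of_bound π 1
    (by simpa using NonUnitalStarAlgHom.norm_apply_le π)
  have hsb : IsSelfAdjoint (π b) := by rw [hπb]; exact ha
  refine ⟨cfcₙ (clamp r) b, ?_, ?_, ?_⟩
  · exact (cfcₙ_predicate (clamp r) b : IsSelfAdjoint _)
  · rw [π.map_cfcₙ (clamp r) b hcl.continuousOn hcl0 πc hb hsb, hπb]
    have hsb' : IsSelfAdjoint (π a) := ha
    conv_rhs => rw [← cfcₙ_id ℝ (π a)]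
    apply cfcₙ_congr
    intro x hx
    have : ‖x‖ ≤ r := NonUnitalIsometricContinuousFunctionalCalculus.norm_quasispectrum_le (π a) hx hsb'
    rw [Real.norm_eq_abs, abs_le] at this
    simp [clamp, this.1, this.2]
  · apply norm_cfcₙ_le 
    intro x hx
    rw [Real.norm_eq_abs, abs_le]
    simp only [clamp]
    exact ⟨le_max_left _ _, max_le (by linarith) (min_le_left _ _)⟩

end
end Tz
end

noncomputable section
open scoped MultiplierAlgebra
open Filter Topology

namespace Tz

section
variable {M G : Type} [CStarAlgebra M] [Group G]

/-- commutator -/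
def dl (x : M) : M →ₗ[ℂ] M := LinearMap.mulRight ℂ x - LinearMap.mulLeft ℂ x

lemma dl_apply (x a : M) : dl x a = a * x - x * a := rfl

/-- displacement -/
def dg (α : M ≃⋆ₐ[ℂ] M) : M →ₗ[ℂ] M where
  toFun a := α a - a
  map_add' a b := by rw [map_add]; abel
  map_smul' c a := by rw [map_smul, RingHom.id_apply, smul_sub]

lemma dg_apply (α : M ≃⋆ₐ[ℂ] M) (a : M) : dg α a = α a - a := rfl

/-- the test maps -/
def δS (x : ℕ → M) (α : G → M ≃⋆ₐ[ℂ] M) : ℕ ⊕ G → M →ₗ[ℂ] M :=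
  Sum.elim (fun k => dl (x k)) (fun g => dg (α g))

/-- the twisted test maps -/
def τS (x : ℕ → M) (α : G → M ≃⋆ₐ[ℂ] M) : ℕ ⊕ G → M →ₗ[ℂ] M :=
  Sum.elim (fun k => dl (x k)) (fun g => - dg (α g⁻¹))

/-- the twists -/
def σS (α : G → M ≃⋆ₐ[ℂ] M) : ℕ ⊕ G → M → M :=
  Sum.elim (fun _ a => a) (fun g a => α g a)

lemma norm_aut (α : M ≃⋆ₐ[ℂ] M) (a : M) : ‖α a‖ = ‖a‖ := by
  apply le_antisymm
  · exact NonUnitalStarAlgHom.norm_apply_le α a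
  · have := NonUnitalStarAlgHom.norm_apply_le α.symm (α a)
    simpa using this

lemma act_one {α : G → M ≃⋆ₐ[ℂ] M} (hα : ∀ g h m, α (g * h) m = α g (α h m)) (m : M) :
    α 1 m = m := by
  have h : α 1 (α 1 m) = α 1 m := by rw [← hα, one_mul]
  exact EquivLike.injective (α 1) h

lemma norm_dl (x : M) (hx : ‖x‖ ≤ 1) (a : M) : ‖dl x a‖ ≤ 2 * ‖a‖ := by
  rw [dl_apply]
  have h1 := norm_sub_le (a * x) (x * a)
  have h2 : ‖a * x‖ ≤ ‖a‖ * 1 := (norm_mul_le _ _).trans (by gcongr)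
  have h3 : ‖x * a‖ ≤ 1 * ‖a‖ := (norm_mul_le _ _).trans (by gcongr)
  linarith

lemma norm_dg (α : M ≃⋆ₐ[ℂ] M) (a : M) : ‖dg α a‖ ≤ 2 * ‖a‖ := by
  rw [dg_apply]
  have h1 := norm_sub_le (α a) a
  rw [norm_aut] at h1
  linarith

lemma testSys (x : ℕ → M) (hx : ∀ n, ‖x n‖ ≤ 1) (α : G → M ≃⋆ₐ[ℂ] M)
    (hα : ∀ g h m, α (g * h) m = α g (α h m)) : TestSys (δS x α) (τS x α) (σS α) where
  δ_mul t a b := by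
    rcases t with k | g
    · simp only [δS, σS, Sum.elim_inl, dl_apply]; noncomm_ring
    · simp only [δS, σS, Sum.elim_inr, dg_apply, map_mul]; noncomm_ring
  δ_one t := by
    rcases t with k | g
    · simp [δS, dl_apply]
    · simp [δS, dg_apply]
  δ_norm t a := by
    rcases t with k | g
    · exact norm_dl _ (hx k) a
    · exact norm_dg _ a
  τ_norm t a := by
    rcases t with k | g
    · exact norm_dl _ (hx k) a
    · simp only [τS, Sum.elim_inr, LinearMap.neg_apply, norm_neg]; exact norm_dg _ a
  σ_norm t a := by
    rcases t with k | g
    · exact le_rfl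
    · exact (norm_aut _ a).le
  tw t a b := by
    rcases t with k | g
    · exact le_rfl
    · simp only [δS, τS, σS, Sum.elim_inr, LinearMap.neg_apply, dg_apply]
      have this : α g (α g⁻¹ a) = a := by rw [← hα, mul_inv_cancel, act_one hα]
      have e1 : (α g a - a) * α g b - (α g a - a)
          = α g (-(α g⁻¹ a - a) * b - -(α g⁻¹ a - a)) := by
        simp only [map_sub, map_mul, map_neg, this]; noncomm_ring
      rw [e1, norm_aut]

end

section
variable {A B : Type} [NonUnitalCStarAlgebra A] [NonUnitalCStarAlgebra B]

/-- `A` as a linear subspace map -/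
def coeL (A : Type) [NonUnitalCStarAlgebra A] : A →ₗ[ℂ] 𝓜(ℂ, A) where
  toFun a := (a : 𝓜(ℂ, A))
  map_add' := coe_add
  map_smul' := coe_smul

/-- the ideal `A` -/
def II (A : Type) [NonUnitalCStarAlgebra A] : Submodule ℂ 𝓜(ℂ, A) := LinearMap.range (coeL A)

lemma mem_II {m : 𝓜(ℂ, A)} : m ∈ II A ↔ ∃ a : A, (a : 𝓜(ℂ, A)) = m := Iff.rfl

lemma coe_mem (a : A) : (a : 𝓜(ℂ, A)) ∈ II A := ⟨a, rfl⟩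

/-- the ideal `J` -/
def JJ (π : A →⋆ₙₐ[ℂ] B) : Submodule ℂ 𝓜(ℂ, A) where
  carrier := {m | ∃ a : A, π a = 0 ∧ (a : 𝓜(ℂ, A)) = m}
  add_mem' := by
    rintro _ _ ⟨a, ha, rfl⟩ ⟨b, hb, rfl⟩
    exact ⟨a + b, by rw [map_add, ha, hb, add_zero], coe_add a b⟩
  zero_mem' := ⟨0, map_zero π, coe_zero⟩
  smul_mem' := by
    rintro c _ ⟨a, ha, rfl⟩
    exact ⟨c • a, by rw [map_smul, ha, smul_zero], coe_smul c a⟩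

lemma mem_JJ {π : A →⋆ₙₐ[ℂ] B} {m : 𝓜(ℂ, A)} :
    m ∈ JJ π ↔ ∃ a : A, π a = 0 ∧ (a : 𝓜(ℂ, A)) = m := Iff.rfl

lemma isClosed_II : IsClosed (II A : Set 𝓜(ℂ, A)) := by
  have : (II A : Set 𝓜(ℂ, A)) = Set.range (fun a : A => (a : 𝓜(ℂ, A))) := rfl
  rw [this]
  exact coe_isometry.isClosedEmbedding.isClosed_range

end

section
variable {A B : Type} [NonUnitalCStarAlgebra A] [NonUnitalCStarAlgebra B]
  {G : Type} [Group G] [TopologicalSpace G] [IsTopologicalGroup G]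
  {αA : G → (A ≃⋆ₐ[ℂ] A)} {αB : G → (B ≃⋆ₐ[ℂ] B)}
  {π : A →⋆ₙₐ[ℂ] B} {πM : 𝓜(ℂ, A) →⋆ₐ[ℂ] 𝓜(ℂ, B)}
  {αMA : G → (𝓜(ℂ, A) ≃⋆ₐ[ℂ] 𝓜(ℂ, A))} {αMB : G → (𝓜(ℂ, B) ≃⋆ₐ[ℂ] 𝓜(ℂ, B))}

lemma δ_mem_II (hαMA : ∀ g (a : A), αMA g (a : 𝓜(ℂ, A)) = ((αA g a : A) : 𝓜(ℂ, A)))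
    (x : ℕ → 𝓜(ℂ, A)) (t : ℕ ⊕ G) (a : A) : δS x αMA t (a : 𝓜(ℂ, A)) ∈ II A := by
  rcases t with k | g
  · simp only [δS, Sum.elim_inl, dl_apply]
    rw [mul_coe, coe_mul_ex, ← coe_sub]; exact coe_mem _
  · simp only [δS, Sum.elim_inr, dg_apply]
    rw [hαMA, ← coe_sub]; exact coe_mem _

lemma τ_mem_II (hαMA : ∀ g (a : A), αMA g (a : 𝓜(ℂ, A)) = ((αA g a : A) : 𝓜(ℂ, A)))
    (x : ℕ → 𝓜(ℂ, A)) (t : ℕ ⊕ G) (a : A) : τS x αMA t (a : 𝓜(ℂ, A)) ∈ II A := by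
  rcases t with k | g
  · simp only [τS, Sum.elim_inl, dl_apply]
    rw [mul_coe, coe_mul_ex, ← coe_sub]; exact coe_mem _
  · simp only [τS, Sum.elim_inr, dg_apply, LinearMap.neg_apply]
    rw [hαMA, ← coe_sub]; exact (II A).neg_mem (coe_mem _)

lemma δ_cont_II (hαMA : ∀ g (a : A), αMA g (a : 𝓜(ℂ, A)) = ((αA g a : A) : 𝓜(ℂ, A)))
    (hαAcont : ∀ a : A, Continuous fun g => αA g a)
    (x : ℕ → 𝓜(ℂ, A)) (a : A) : Continuous fun t => δS x αMA t (a : 𝓜(ℂ, A)) := by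
  rw [continuous_sum_dom]
  refine ⟨continuous_of_discreteTopology, ?_⟩
  simp only [δS, Function.comp_def, Sum.elim_inr, dg_apply, hαMA]
  exact (coe_isometry.continuous.comp (hαAcont a)).sub continuous_const

lemma τ_cont_II (hαMA : ∀ g (a : A), αMA g (a : 𝓜(ℂ, A)) = ((αA g a : A) : 𝓜(ℂ, A)))
    (hαAcont : ∀ a : A, Continuous fun g => αA g a)
    (x : ℕ → 𝓜(ℂ, A)) (a : A) : Continuous fun t => τS x αMA t (a : 𝓜(ℂ, A)) := by
  rw [continuous_sum_dom]
  refine ⟨continuous_of_discreteTopology, ?_⟩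
  simp only [τS, Function.comp_def, Sum.elim_inr, dg_apply, hαMA, LinearMap.neg_apply]
  exact ((coe_isometry.continuous.comp ((hαAcont a).comp continuous_inv)).sub continuous_const).neg

lemma good_II (hαMA : ∀ g (a : A), αMA g (a : 𝓜(ℂ, A)) = ((αA g a : A) : 𝓜(ℂ, A)))
    (hαAcont : ∀ a : A, Continuous fun g => αA g a)
    (hπsurj : Function.Surjective π)
    (hπM : ∀ a : A, πM (a : 𝓜(ℂ, A)) = ((π a : B) : 𝓜(ℂ, B)))
    (x : ℕ → 𝓜(ℂ, A)) (z : 𝓜(ℂ, B)) (e : ℕ → A) (he : ∀ n, star (e n) = e n) (he1 : ∀ n, ‖e n‖ ≤ 1)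
    (het : ∀ x : A, Tendsto (fun n => e n * x) atTop (𝓝 x)) :
    GoodIdeal (δS x αMA) (τS x αMA) πM z (II A) (fun n => (e n : 𝓜(ℂ, A))) where
  mul_left := by rintro m _ ⟨a, rfl⟩; exact ⟨_, (mul_coe m a).symm⟩
  star_mem := by rintro _ ⟨a, rfl⟩; exact ⟨_, coe_star a⟩
  δ_mem := by rintro t _ ⟨a, rfl⟩; exact δ_mem_II hαMA x t a
  τ_mem := by rintro t _ ⟨a, rfl⟩; exact τ_mem_II hαMA x t a
  δ_cont := by rintro _ ⟨a, rfl⟩; exact δ_cont_II hαMA hαAcont x a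
  τ_cont := by rintro _ ⟨a, rfl⟩; exact τ_cont_II hαMA hαAcont x a
  zr := by
    rintro _ ⟨a, rfl⟩
    obtain ⟨a', ha'⟩ := hπsurj (z.snd (π a))
    refine ⟨a', coe_mem _, ?_⟩
    change _ = πM (a : 𝓜(ℂ, A)) * z
    rw [hπM, hπM, ha', coe_mul_ex]
  zl := by
    rintro _ ⟨a, rfl⟩
    obtain ⟨a', ha'⟩ := hπsurj (z.fst (π a))
    refine ⟨a', coe_mem _, ?_⟩
    change _ = z * πM (a : 𝓜(ℂ, A))
    rw [hπM, hπM, ha', mul_coe]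
  e_mem n := coe_mem _
  e_star n := by rw [← coe_star, he]
  e_norm n := by rw [norm_coe]; exact he1 n
  e_tend := by
    rintro _ ⟨a, rfl⟩
    have := (coe_isometry.continuous.tendsto _).comp (het a)
    change Tendsto (fun n => (e n : 𝓜(ℂ, A)) * (a : 𝓜(ℂ, A))) atTop (𝓝 (a : 𝓜(ℂ, A)))
    simpa only [Function.comp_def, coe_mul] using this

lemma JJ_iff (hπM : ∀ a : A, πM (a : 𝓜(ℂ, A)) = ((π a : B) : 𝓜(ℂ, B))) (m : 𝓜(ℂ, A)) :
    m ∈ JJ π ↔ m ∈ II A ∧ πM m = 0 := by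
  constructor
  · rintro ⟨a, ha, rfl⟩
    exact ⟨coe_mem a, by rw [hπM, ha, coe_zero]⟩
  · rintro ⟨⟨a, rfl⟩, h⟩
    refine ⟨a, coe_inj ?_, rfl⟩
    rw [← hπM, coe_zero]; exact h

lemma equi_coe (hπequi : ∀ g a, π (αA g a) = αB g (π a))
    (hπM : ∀ a : A, πM (a : 𝓜(ℂ, A)) = ((π a : B) : 𝓜(ℂ, B)))
    (hαMA : ∀ g (a : A), αMA g (a : 𝓜(ℂ, A)) = ((αA g a : A) : 𝓜(ℂ, A)))
    (hαMB : ∀ g (b : B), αMB g (b : 𝓜(ℂ, B)) = ((αB g b : B) : 𝓜(ℂ, B)))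
    (g : G) (a : A) : πM (αMA g (a : 𝓜(ℂ, A))) = αMB g (πM (a : 𝓜(ℂ, A))) := by
  rw [hαMA, hπM, hπequi, hπM, hαMB]

lemma equi_M (hπsurj : Function.Surjective π) (hπequi : ∀ g a, π (αA g a) = αB g (π a))
    (hπM : ∀ a : A, πM (a : 𝓜(ℂ, A)) = ((π a : B) : 𝓜(ℂ, B)))
    (hαMA : ∀ g (a : A), αMA g (a : 𝓜(ℂ, A)) = ((αA g a : A) : 𝓜(ℂ, A)))
    (hαMB : ∀ g (b : B), αMB g (b : 𝓜(ℂ, B)) = ((αB g b : B) : 𝓜(ℂ, B)))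
    (g : G) (m : 𝓜(ℂ, A)) : πM (αMA g m) = αMB g (πM m) := by
  have key := equi_coe hπequi hπM hαMA hαMB
  rw [← sub_eq_zero]
  apply ess
  intro b
  obtain ⟨b', rfl⟩ : ∃ b', αB g b' = b := EquivLike.surjective (αB g) b
  obtain ⟨a, rfl⟩ := hπsurj b'
  rw [← hαMB, ← hπM, sub_mul, ← map_mul, ← map_mul, ← key, ← map_mul, ← map_mul, mul_coe, key,
    sub_self]

lemma good_JJ (hπequi : ∀ g a, π (αA g a) = αB g (π a))
    (hαMA : ∀ g (a : A), αMA g (a : 𝓜(ℂ, A)) = ((αA g a : A) : 𝓜(ℂ, A)))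
    (hαMB : ∀ g (b : B), αMB g (b : 𝓜(ℂ, B)) = ((αB g b : B) : 𝓜(ℂ, B)))
    (hαAcont : ∀ a : A, Continuous fun g => αA g a)
    (hπM : ∀ a : A, πM (a : 𝓜(ℂ, A)) = ((π a : B) : 𝓜(ℂ, B)))
    (x : ℕ → 𝓜(ℂ, A)) (z : 𝓜(ℂ, B)) (e : ℕ → A) (he : ∀ n, star (e n) = e n) (he1 : ∀ n, ‖e n‖ ≤ 1)
    (heπ : ∀ n, π (e n) = 0)
    (het : ∀ x : A, π x = 0 → Tendsto (fun n => e n * x) atTop (𝓝 x)) :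
    GoodIdeal (δS x αMA) (τS x αMA) πM z (JJ π) (fun n => (e n : 𝓜(ℂ, A))) where
  mul_left := by
    intro m a ha
    rw [JJ_iff hπM] at ha ⊢
    obtain ⟨⟨a, rfl⟩, h⟩ := ha
    exact ⟨⟨_, (mul_coe m a).symm⟩, by rw [map_mul, h, mul_zero]⟩
  star_mem := by
    intro a ha
    rw [JJ_iff hπM] at ha ⊢
    obtain ⟨⟨a, rfl⟩, h⟩ := ha
    exact ⟨⟨_, coe_star a⟩, by rw [map_star, h, star_zero]⟩
  δ_mem := by
    intro t a ha
    rw [JJ_iff hπM] at ha ⊢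
    obtain ⟨⟨a, rfl⟩, h⟩ := ha
    refine ⟨δ_mem_II hαMA x t a, ?_⟩
    have h' : πM (a : 𝓜(ℂ, A)) = 0 := h
    change πM (δS x αMA t (a : 𝓜(ℂ, A))) = 0
    rcases t with k | g
    · simp only [δS, Sum.elim_inl, dl_apply, map_sub, map_mul, h', zero_mul, mul_zero, sub_zero]
    · simp only [δS, Sum.elim_inr, dg_apply, map_sub, equi_coe hπequi hπM hαMA hαMB, h', map_zero,
        sub_zero]
  τ_mem := by
    intro t a ha
    rw [JJ_iff hπM] at ha ⊢
    obtain ⟨⟨a, rfl⟩, h⟩ := ha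
    refine ⟨τ_mem_II hαMA x t a, ?_⟩
    have h' : πM (a : 𝓜(ℂ, A)) = 0 := h
    change πM (τS x αMA t (a : 𝓜(ℂ, A))) = 0
    rcases t with k | g
    · simp only [τS, Sum.elim_inl, dl_apply, map_sub, map_mul, h', zero_mul, mul_zero, sub_zero]
    · simp only [τS, Sum.elim_inr, dg_apply, LinearMap.neg_apply, map_neg, map_sub,
        equi_coe hπequi hπM hαMA hαMB, h', map_zero, sub_zero, neg_zero]
  δ_cont := by rintro _ ⟨a, -, rfl⟩; exact δ_cont_II hαMA hαAcont x a
  τ_cont := by rintro _ ⟨a, -, rfl⟩; exact τ_cont_II hαMA hαAcont x a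
  zr := by
    intro a ha
    rw [JJ_iff hπM] at ha
    exact ⟨0, (JJ π).zero_mem, by rw [ha.2, map_zero, zero_mul]⟩
  zl := by
    intro a ha
    rw [JJ_iff hπM] at ha
    exact ⟨0, (JJ π).zero_mem, by rw [ha.2, map_zero, mul_zero]⟩
  e_mem n := ⟨e n, heπ n, rfl⟩
  e_star n := by rw [← coe_star, he]
  e_norm n := by rw [norm_coe]; exact he1 n
  e_tend := by
    rintro _ ⟨a, ha, rfl⟩
    have := (coe_isometry.continuous.tendsto _).comp (het a ha)
    simpa only [Function.comp_def, coe_mul] using this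

lemma core [LocallyCompactSpace G] [SigmaCompactSpace G]
    (hαAcont : ∀ a : A, Continuous fun g => αA g a)
    (hπsurj : Function.Surjective π)
    (hπequi : ∀ g a, π (αA g a) = αB g (π a))
    (hπM : ∀ a : A, πM (a : 𝓜(ℂ, A)) = ((π a : B) : 𝓜(ℂ, B)))
    (hαMA : ∀ g (a : A), αMA g (a : 𝓜(ℂ, A)) = ((αA g a : A) : 𝓜(ℂ, A)))
    (hαMB : ∀ g (b : B), αMB g (b : 𝓜(ℂ, B)) = ((αB g b : B) : 𝓜(ℂ, B)))
    (hαMAmul : ∀ g h m, αMA (g * h) m = αMA g (αMA h m))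
    (e : ℕ → A) (he : ∀ n, star (e n) = e n) (he1 : ∀ n, ‖e n‖ ≤ 1)
    (het : ∀ x : A, Tendsto (fun n => e n * x) atTop (𝓝 x))
    (j : ℕ → A) (hj : ∀ n, star (j n) = j n) (hj1 : ∀ n, ‖j n‖ ≤ 1) (hjπ : ∀ n, π (j n) = 0)
    (hjt : ∀ x : A, π x = 0 → Tendsto (fun n => j n * x) atTop (𝓝 x))
    (x : ℕ → 𝓜(ℂ, A)) (hx : ∀ n, ‖x n‖ ≤ 1) (z : 𝓜(ℂ, B)) (hz : star z = z)
    (hzx : ∀ n, z * πM (x n) = πM (x n) * z) (hzinv : ∀ g : G, αMB g z = z) :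
    ∃ y : 𝓜(ℂ, A), πM y = z ∧ (∀ n, y * x n - x n * y ∈ II A) ∧
      (∀ g : G, αMA g y - y ∈ II A) ∧ Continuous fun g : G => αMA g y := by
  have H : ExtSys (δS x αMA) (τS x αMA) (σS αMA) πM z (II A) (JJ π)
      (fun n => (e n : 𝓜(ℂ, A))) (fun n => (j n : 𝓜(ℂ, A))) :=
    { hT := testSys x hx αMA hαMAmul
      hz := hz
      hI := good_II hαMA hαAcont hπsurj hπM x z e he he1 het
      hJ := good_JJ hπequi hαMA hαMB hαAcont hπM x z j hj hj1 hjπ hjt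
      J_iff := JJ_iff hπM
      lift := by
        rintro _ ⟨a, rfl⟩ ha
        change star (πM (a : 𝓜(ℂ, A))) = πM (a : 𝓜(ℂ, A)) at ha
        rw [hπM, ← coe_star] at ha
        obtain ⟨c, hc1, hc2, hc3⟩ := exists_lift π a (coe_inj ha)
        refine ⟨c, coe_mem c, by rw [← coe_star, hc1], ?_, ?_⟩
        · change _ = πM (a : 𝓜(ℂ, A))
          rw [hπM, hπM, hc2]
        · change _ ≤ ‖πM (a : 𝓜(ℂ, A))‖
          rw [hπM, norm_coe, norm_coe]; exact hc3
      Φδ := by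
        intro t u _ c hc _ hcu
        have hu := hom_norm πM u
        rcases t with k | g
        · have e1 : πM (δS x αMA (Sum.inl k) c) = πM u * z * πM (δS x αMA (Sum.inl k) u)
              + πM (δS x αMA (Sum.inl k) u) * z * πM u := by
            simp only [δS, Sum.elim_inl, dl_apply, map_sub, map_mul, hcu]
            have h1 := hzx k
            have h2 : πM u * z * (πM (x k) * πM u) = πM u * (πM (x k) * z) * πM u := by
              rw [← h1]; noncomm_ring
            rw [mul_sub, sub_mul, sub_mul, h2]
            noncomm_ring
          have hd := hom_norm πM (δS x αMA (Sum.inl k) u)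
          rw [e1]
          refine (norm_add_le _ _).trans ?_
          have i1 : ‖πM u * z * πM (δS x αMA (Sum.inl k) u)‖ ≤ ‖u‖ * ‖z‖ * ‖δS x αMA (Sum.inl k) u‖ :=
            (norm_mul_le _ _).trans (by gcongr; exact (norm_mul_le _ _).trans (by gcongr))
          have i2 : ‖πM (δS x αMA (Sum.inl k) u) * z * πM u‖ ≤ ‖δS x αMA (Sum.inl k) u‖ * ‖z‖ * ‖u‖ :=
            (norm_mul_le _ _).trans (by gcongr; exact (norm_mul_le _ _).trans (by gcongr))
          linarith
        · have e0 : ∀ m, πM (αMA g m) = αMB g (πM m) := equi_M hπsurj hπequi hπM hαMA hαMB g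
          have e1 : πM (δS x αMA (Sum.inr g) c) = πM u * z * πM (δS x αMA (Sum.inr g) u)
              + πM (δS x αMA (Sum.inr g) u) * z * πM (αMA g u) := by
            simp only [δS, Sum.elim_inr, dg_apply, map_sub, e0, hcu, map_mul, hzinv]
            noncomm_ring
          have hd := hom_norm πM (δS x αMA (Sum.inr g) u)
          have hu' := hom_norm πM (αMA g u)
          rw [norm_aut] at hu'
          rw [e1]
          refine (norm_add_le _ _).trans ?_
          have i1 : ‖πM u * z * πM (δS x αMA (Sum.inr g) u)‖ ≤ ‖u‖ * ‖z‖ * ‖δS x αMA (Sum.inr g) u‖ :=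
            (norm_mul_le _ _).trans (by gcongr; exact (norm_mul_le _ _).trans (by gcongr))
          have i2 : ‖πM (δS x αMA (Sum.inr g) u) * z * πM (αMA g u)‖
              ≤ ‖δS x αMA (Sum.inr g) u‖ * ‖z‖ * ‖u‖ :=
            (norm_mul_le _ _).trans (by gcongr; exact (norm_mul_le _ _).trans (by gcongr))
          linarith }
  let Ke := CompactExhaustion.choice G
  let K : ℕ → Set (ℕ ⊕ G) := fun n => (Sum.inl '' Set.Iic n) ∪ (Sum.inr '' Ke n)
  have hK : ∀ n, IsCompact (K n) := fun n =>
    ((Set.finite_Iic n).image _).isCompact.union ((Ke.isCompact n).image continuous_inr)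
  have hKm : ∀ n, K n ⊆ K (n + 1) := fun n => Set.union_subset_union
    (Set.image_mono (Set.Iic_subset_Iic.2 (Nat.le_succ n)))
    (Set.image_mono (Ke.subset_succ n))
  obtain ⟨y, hy1, hy2, hy3⟩ := H.main hK hKm isClosed_II
    (fun P h1 h2 => by
      obtain ⟨y, hy⟩ := strict_complete P (fun a => h1 _ (coe_mem a)) (fun a => h2 _ (coe_mem a))
      exact ⟨y, by rintro _ ⟨a, rfl⟩; exact hy a⟩)
    (by
      rintro (k | g) m hm
      · exact ess m fun a => hm _ (coe_mem a)
      · refine ess m fun a => ?_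
        obtain ⟨b, rfl⟩ : ∃ b, αA g b = a := EquivLike.surjective (αA g) a
        rw [← hαMA]
        exact hm _ (coe_mem b))
    (fun n hn => ess n fun b => by
      obtain ⟨a, rfl⟩ := hπsurj b
      rw [← hπM]; exact hn _ (coe_mem a))
    (by
      have : πM '' (II A : Set 𝓜(ℂ, A)) = (II B : Set 𝓜(ℂ, B)) := by
        ext m
        constructor
        · rintro ⟨_, ⟨a, rfl⟩, rfl⟩
          exact ⟨π a, (hπM a).symm⟩
        · rintro ⟨b, rfl⟩
          obtain ⟨a, rfl⟩ := hπsurj b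
          exact ⟨_, coe_mem a, hπM a⟩
      rw [this]; exact isClosed_II)
  refine ⟨y, hy1, fun n => ?_, fun g => ?_, ?_⟩
  · exact hy2 n (Sum.inl n) (Or.inl ⟨n, Set.mem_Iic.2 le_rfl, rfl⟩)
  · obtain ⟨n, hn⟩ := Ke.exists_mem g
    exact hy2 n (Sum.inr g) (Or.inr ⟨g, hn, rfl⟩)
  · rw [continuous_iff_continuousAt]
    intro g
    obtain ⟨n, hn⟩ := Ke.exists_mem g
    have hnb : Ke (n + 1) ∈ 𝓝 g := mem_interior_iff_mem_nhds.1 (Ke.subset_interior_succ n hn)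
    have h1 : ContinuousOn (fun g => δS x αMA (Sum.inr g) y) (Ke (n + 1)) :=
      (hy3 (n + 1)).comp continuous_inr.continuousOn (fun g hg => Or.inr ⟨g, hg, rfl⟩)
    have h2 := (h1.continuousAt hnb).add (continuousAt_const (y := y))
    have e : (fun g => αMA g y) = (fun g => δS x αMA (Sum.inr g) y) + fun _ => y := by
      funext g
      simp [δS, dg_apply]
    rw [e]
    exact h2

end
end Tz
end

namespace Tz

lemma dec_re_im {M : Type} [CStarAlgebra M] (z : M) : z = (2⁻¹ * 1 : ℂ) • (z + star z)
    + Complex.I • ((2⁻¹ * Complex.I : ℂ) • (star z - z)) := by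
  rw [smul_smul]
  have h : Complex.I * (2⁻¹ * Complex.I) = -2⁻¹ := by
    rw [mul_left_comm, Complex.I_mul_I]; ring
  rw [h, mul_one, neg_smul, ← smul_neg, neg_sub, ← smul_add]
  rw [show z + star z + (z - star z) = (2 : ℂ) • z by rw [two_smul]; abel, smul_smul]
  simp

lemma comm_re_im {M : Type} [CStarAlgebra M] (y1 y2 x : M) :
    (y1 + Complex.I • y2) * x - x * (y1 + Complex.I • y2)
      = (y1 * x - x * y1) + Complex.I • (y2 * x - x * y2) := by
  rw [add_mul, mul_add, smul_mul_assoc, mul_smul_comm, smul_sub]; abel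

lemma cont_re_im {M T : Type} [CStarAlgebra M] [TopologicalSpace T] {f g : T → M}
    (hf : Continuous f) (hg : Continuous g) : Continuous fun t => f t + Complex.I • g t := by
  fun_prop

end Tz

theorem statement1
    -- `G` a locally compact, σ-compact topological group
    (G : Type) [Group G] [TopologicalSpace G] [IsTopologicalGroup G]
    [LocallyCompactSpace G] [SigmaCompactSpace G]
    -- σ-unital C*-algebras `A`, `B`
    (A B : Type) [NonUnitalCStarAlgebra A] [NonUnitalCStarAlgebra B]
    [PartialOrder A] [StarOrderedRing A] [PartialOrder B] [StarOrderedRing B]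
    (hAσ : SigmaUnital A) (hBσ : SigmaUnital B)
    -- point-norm continuous actions of `G` on `A` and `B`
    (αA : G → (A ≃⋆ₐ[ℂ] A)) (αB : G → (B ≃⋆ₐ[ℂ] B))
    (hαA : ∀ g h x, αA (g * h) x = αA g (αA h x))
    (hαB : ∀ g h x, αB (g * h) x = αB g (αB h x))
    (hαA1 : ∀ x, αA 1 x = x) (hαB1 : ∀ x, αB 1 x = x)
    (hαAcont : ∀ a : A, Continuous fun g => αA g a)
    (hαBcont : ∀ b : B, Continuous fun g => αB g b)
    -- the extension: a surjective equivariant *-homomorphism with σ-unital kernel `J`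
    (π : A →⋆ₙₐ[ℂ] B) (hπsurj : Function.Surjective π)
    (hπequi : ∀ g a, π (αA g a) = αB g (π a))
    (hJσ : ∃ e : ℕ → A, (∀ n, π (e n) = 0 ∧ 0 ≤ e n ∧ ‖e n‖ ≤ 1) ∧
      ∀ x : A, π x = 0 → Filter.Tendsto (fun n => e n * x) Filter.atTop (nhds x))
    -- the induced homomorphism `π° : 𝓜(A) → 𝓜(B)`, characterized by extending `π`
    (πM : 𝓜(ℂ, A) →⋆ₐ[ℂ] 𝓜(ℂ, B))
    (hπM : ∀ a : A, πM (a : 𝓜(ℂ, A)) = ((π a : B) : 𝓜(ℂ, B)))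
    -- the canonical extensions of the actions to the multiplier algebras
    (αMA : G → (𝓜(ℂ, A) ≃⋆ₐ[ℂ] 𝓜(ℂ, A))) (αMB : G → (𝓜(ℂ, B) ≃⋆ₐ[ℂ] 𝓜(ℂ, B)))
    (hαMA : ∀ g (a : A), αMA g (a : 𝓜(ℂ, A)) = ((αA g a : A) : 𝓜(ℂ, A)))
    (hαMB : ∀ g (b : B), αMB g (b : 𝓜(ℂ, B)) = ((αB g b : B) : 𝓜(ℂ, B)))
    (hαMAmul : ∀ g h m, αMA (g * h) m = αMA g (αMA h m))
    (hαMBmul : ∀ g h m, αMB (g * h) m = αMB g (αMB h m))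
    -- `X ⊆ 𝓜(A)` a norm-separable self-adjoint subspace
    (X : Submodule ℂ 𝓜(ℂ, A))
    (hXsep : TopologicalSpace.IsSeparable (X : Set 𝓜(ℂ, A)))
    (hXsa : ∀ x ∈ X, star x ∈ X)
    -- `z` in the commutant of `π°(X)`, invariant under `G`
    (z : 𝓜(ℂ, B))
    (hzcomm : ∀ x ∈ X, z * πM x = πM x * z)
    (hzinv : ∀ g : G, αMB g z = z) :
    -- conclusion
    ∃ y : 𝓜(ℂ, A),
      πM y = z ∧
      (∀ x ∈ X, ∃ a : A, π a = 0 ∧ ((a : 𝓜(ℂ, A)) = y * x - x * y)) ∧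
      (∀ g : G, ∃ a : A, π a = 0 ∧ ((a : 𝓜(ℂ, A)) = αMA g y - y)) ∧
      Continuous fun g : G => αMA g y := by
  classical
  obtain ⟨e, he, het⟩ := hAσ
  obtain ⟨j, hj, hjt⟩ := hJσ
  -- a dense sequence in X
  obtain ⟨d, hdX, hd⟩ : ∃ d : ℕ → 𝓜(ℂ, A), (∀ n, d n ∈ X) ∧ (X : Set 𝓜(ℂ, A)) ⊆
      closure (Set.range d) := by
    haveI : TopologicalSpace.SeparableSpace (X : Set 𝓜(ℂ, A)) := hXsep.separableSpace
    haveI : Nonempty (X : Set 𝓜(ℂ, A)) := ⟨⟨0, X.zero_mem⟩⟩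
    refine ⟨fun n => (TopologicalSpace.denseSeq (X : Set 𝓜(ℂ, A)) n : 𝓜(ℂ, A)),
      fun n => (TopologicalSpace.denseSeq (X : Set 𝓜(ℂ, A)) n).2, fun w hw => ?_⟩
    have h1 := TopologicalSpace.denseRange_denseSeq (X : Set 𝓜(ℂ, A)) ⟨w, hw⟩
    rw [closure_subtype] at h1
    rw [← Set.range_comp] at h1
    exact h1
  let x : ℕ → 𝓜(ℂ, A) := fun n => (((1 + ‖d n‖)⁻¹ : ℝ) : ℂ) • d n
  have hpos : ∀ n, 0 < 1 + ‖d n‖ := fun n => by positivity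
  have hx : ∀ n, ‖x n‖ ≤ 1 := by
    intro n
    have hp := hpos n
    simp only [x]
    rw [norm_smul, Complex.norm_real, Real.norm_of_nonneg (inv_nonneg.2 hp.le),
      inv_mul_le_iff₀ hp]
    linarith
  have hxX : ∀ n, x n ∈ X := fun n => X.smul_mem _ (hdX n)
  have hdx : ∀ n, d n = ((1 + ‖d n‖ : ℝ) : ℂ) • x n := by
    intro n
    simp only [x]
    rw [smul_smul, ← Complex.ofReal_mul, mul_inv_cancel₀ (hpos n).ne', Complex.ofReal_one, one_smul]
  -- the selfadjoint case
  have key : ∀ w : 𝓜(ℂ, B), star w = w → (∀ x ∈ X, w * πM x = πM x * w) →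
      (∀ g : G, αMB g w = w) → ∃ y, πM y = w ∧ (∀ n, y * x n - x n * y ∈ Tz.II A) ∧
      (∀ g, αMA g y - y ∈ Tz.II A) ∧ Continuous fun g => αMA g y := by
    intro w hw hwX hwi
    exact Tz.core hαAcont hπsurj hπequi hπM hαMA hαMB hαMAmul
      e (fun n => (IsSelfAdjoint.of_nonneg (he n).1).star_eq) (fun n => (he n).2) het
      j (fun n => (IsSelfAdjoint.of_nonneg (hj n).2.1).star_eq) (fun n => (hj n).2.2)
      (fun n => (hj n).1) hjt x hx w hw (fun n => hwX _ (hxX n)) hwi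
  have hsX : ∀ x ∈ X, star z * πM x = πM x * star z := by
    intro x hx
    have h1 := congrArg star (hzcomm _ (hXsa x hx))
    rw [star_mul, star_mul, map_star, star_star] at h1
    exact h1.symm
  have hsi : ∀ g : G, αMB g (star z) = star z := fun g => by rw [map_star, hzinv]
  obtain ⟨y1, hy1, hc1, hg1, hn1⟩ := key ((2⁻¹ * 1 : ℂ) • (z + star z))
    (by rw [star_smul]; simp [add_comm])
    (fun x hx => by rw [smul_mul_assoc, mul_smul_comm, add_mul, mul_add, hzcomm x hx, hsX x hx])
    (fun g => by rw [map_smul, map_add, hzinv, hsi])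
  obtain ⟨y2, hy2, hc2, hg2, hn2⟩ := key ((2⁻¹ * Complex.I : ℂ) • (star z - z))
    (by
      rw [star_smul]; simp only [star_sub, star_star, star_mul', star_inv₀, star_ofNat]
      rw [show star Complex.I = - Complex.I from Complex.conj_I, mul_neg, neg_smul, ← smul_neg,
        neg_sub])
    (fun x hx => by rw [smul_mul_assoc, mul_smul_comm, sub_mul, mul_sub, hzcomm x hx, hsX x hx])
    (fun g => by rw [map_smul, map_sub, hzinv, hsi])
  have hdec : z = (2⁻¹ * 1 : ℂ) • (z + star z)
      + Complex.I • ((2⁻¹ * Complex.I : ℂ) • (star z - z)) := Tz.dec_re_im z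
  have hyz : πM (y1 + Complex.I • y2) = z := by
    rw [map_add, map_smul, hy1, hy2, ← hdec]
  have hcx : ∀ n, (y1 + Complex.I • y2) * x n - x n * (y1 + Complex.I • y2) ∈ Tz.II A := by
    intro n
    have e1 : (y1 + Complex.I • y2) * x n - x n * (y1 + Complex.I • y2)
        = (y1 * x n - x n * y1) + Complex.I • (y2 * x n - x n * y2) :=
      Tz.comm_re_im y1 y2 (x n)
    rw [e1]
    exact (Tz.II A).add_mem (hc1 n) ((Tz.II A).smul_mem _ (hc2 n))
  have hag : ∀ g, αMA g (y1 + Complex.I • y2) = αMA g y1 + Complex.I • αMA g y2 := fun g => by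
    rw [map_add, map_smul]
  refine ⟨y1 + Complex.I • y2, hyz, ?_, ?_, ?_⟩
  · generalize y1 + Complex.I • y2 = y at hyz hcx
    intro w hw
    refine (Tz.JJ_iff hπM _).2 ⟨?_, ?_⟩
    · have hcl : IsClosed {w : 𝓜(ℂ, A) | y * w - w * y ∈ Tz.II A} := by
        have hc : Continuous fun w : 𝓜(ℂ, A) => y * w - w * y :=
          (continuous_const.mul continuous_id).sub (continuous_id.mul continuous_const)
        exact Tz.isClosed_II.preimage hc
      refine closure_minimal ?_ hcl (hd hw)
      rintro _ ⟨n, rfl⟩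
      change y * d n - d n * y ∈ Tz.II A
      rw [hdx n, mul_smul_comm, smul_mul_assoc, ← smul_sub]
      exact (Tz.II A).smul_mem _ (hcx n)
    · rw [map_sub, map_mul, map_mul, hyz, hzcomm w hw, sub_self]
  · intro g
    refine (Tz.JJ_iff hπM _).2 ⟨?_, ?_⟩
    · rw [hag, add_sub_add_comm, ← smul_sub]
      exact (Tz.II A).add_mem (hg1 g) ((Tz.II A).smul_mem _ (hg2 g))
    · rw [map_sub, Tz.equi_M hπsurj hπequi hπM hαMA hαMB, hyz, hzinv, sub_self]
  · simp only [hag]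
    exact Tz.cont_re_im hn1 hn2

end
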